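/- arXiv:1912.03409 — 2 statements merged into one kernel-verified Lean document; each statement's English description precedes it below -/
import Mathlib

section
/- Suppose the cocycle (ψ,ϑ) is σ-periodic and (H1), (H2) with j = 1 and (H3) hold. Then for any amenable complete trajectory u* at q ∈ Q whose image on [0,∞) is bounded, there exists a σ-periodic trajectory v* at q such that u*(t) − v*(t) → 0 as t → +∞. -/
open MeasureTheory Set Bornology Filter Topology RealInnerProductSpace

noncomputable section

variable {Q H : Type*}

section Defs
variable [MetricSpace Q] [NormedAddCommGroup H] [InnerProductSpace ℝ H] [CompleteSpace H]

def IsFlow (ϑ : ℝ → Q → Q) : Prop :=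
  (∀ q, ϑ 0 q = q) ∧ (∀ t s q, ϑ (t + s) q = ϑ t (ϑ s q)) ∧
    Continuous fun p : ℝ × Q => ϑ p.1 p.2

def IsCocycle (ϑ : ℝ → Q → Q) (ψ : ℝ → Q → H → H) : Prop :=
  (∀ q u, ψ 0 q u = u) ∧
  (∀ t s : ℝ, 0 ≤ t → 0 ≤ s → ∀ q u, ψ (t + s) q u = ψ t (ϑ s q) (ψ s q u)) ∧
  ContinuousOn (fun p : ℝ × Q × H => ψ p.1 p.2.1 p.2.2) {p : ℝ × Q × H | 0 ≤ p.1}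

def IsCompleteTraj (ϑ : ℝ → Q → Q) (ψ : ℝ → Q → H → H) (q : Q) (u : ℝ → H) : Prop :=
  Continuous u ∧ ∀ t s : ℝ, 0 ≤ t → u (t + s) = ψ t (ϑ s q) (u s)

def IsAmenable (ν : ℝ) (u : ℝ → H) : Prop :=
  IntegrableOn (fun s : ℝ => Real.exp (2 * ν * s) * ‖u s‖ ^ 2) (Set.Iic (0:ℝ))

def amenSet (ϑ : ℝ → Q → Q) (ψ : ℝ → Q → H → H) (ν : ℝ) (q : Q) : Set H :=
  {u₀ | ∃ u : ℝ → H, IsCompleteTraj ϑ ψ q u ∧ IsAmenable ν u ∧ u 0 = u₀}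

structure HypH1 (P : H →L[ℝ] H) (Hplus Hminus : Submodule ℝ H) : Prop where
  selfAdj : IsSelfAdjoint P
  closed_plus : IsClosed (Hplus : Set H)
  orth : Hminus = Hplusᗮ
  inv_plus : ∀ u ∈ Hplus, P u ∈ Hplus
  inv_minus : ∀ u ∈ Hminus, P u ∈ Hminus
  pos : ∀ u ∈ Hplus, u ≠ 0 → (0:ℝ) < ⟪P u, u⟫
  neg : ∀ u ∈ Hminus, u ≠ 0 → ⟪P u, u⟫ < 0

def HypH2 (Hminus : Submodule ℝ H) (j : ℕ) : Prop :=
  FiniteDimensional ℝ Hminus ∧ Module.finrank ℝ Hminus = j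

def HypH3 (ψ : ℝ → Q → H → H) (P : H →L[ℝ] H) (δ ν : ℝ) : Prop :=
  0 < δ ∧ 0 < ν ∧ ∀ (q : Q) (u v : H) (l r : ℝ), 0 ≤ l → l ≤ r →
    Real.exp (2 * ν * r) * ⟪P (ψ r q u - ψ r q v), ψ r q u - ψ r q v⟫ -
      Real.exp (2 * ν * l) * ⟪P (ψ l q u - ψ l q v), ψ l q u - ψ l q v⟫ ≤
      -δ * ∫ s in l..r, Real.exp (2 * ν * s) * ‖ψ s q u - ψ s q v‖ ^ 2

def IsOrthProjOnto (Hminus : Submodule ℝ H) (Pi : H →L[ℝ] H) : Prop :=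
  (∀ u, Pi u ∈ Hminus) ∧ ∀ u, u - Pi u ∈ Hminusᗮ

def HypCOM2 (ψ : ℝ → Q → H → H) : Prop :=
  ∃ tc : ℝ, 0 < tc ∧ ∀ (q : Q) (s : Set H), IsBounded s → IsCompact (closure (ψ tc q '' s))

def HypCOM3 (ψ : ℝ → Q → H → H) : Prop :=
  ∀ (q : Q) (u₀ : H), IsBounded ((fun t => ψ t q u₀) '' Set.Ici (0:ℝ)) →
    IsCompact (closure ((fun t => ψ t q u₀) '' Set.Ici (0:ℝ)))

def LyapunovStable (ψ : ℝ → Q → H → H) (q : Q) (v : ℝ → H) : Prop :=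
  ∀ ε > 0, ∃ η > 0, ∀ u₀ : H, ‖u₀ - v 0‖ < η → ∀ t ≥ 0, ‖ψ t q u₀ - v t‖ < ε

end Defs

def circleFlow (σ : ℝ) : ℝ → AddCircle σ → AddCircle σ := fun t θ => θ + (t : AddCircle σ)


section Aux

variable {H : Type*} [NormedAddCommGroup H] [InnerProductSpace ℝ H] [CompleteSpace H]

theorem aux_lower_bound (P : H →L[ℝ] H) (Hplus Hminus : Submodule ℝ H)
    (h1 : HypH1 P Hplus Hminus) (h2 : HypH2 Hminus 1) :
    ∃ (e : H) (K : ℝ), 0 < K ∧ ∀ w : H, -⟪P w, w⟫ ≤ K * ⟪e, w⟫ ^ 2 := by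
  obtain ⟨_, hr⟩ := h2
  obtain ⟨e, he0, he⟩ := finrank_eq_one_iff'.1 hr
  have hene : (e : H) ≠ 0 := by simpa using he0
  have hnorm : 0 < ‖(e : H)‖ := norm_pos_iff.2 hene
  have hneg := h1.neg e e.2 hene
  refine ⟨e, -⟪P (e : H), (e : H)⟫ / ‖(e : H)‖ ^ 4, by
    apply div_pos <;> [linarith; positivity], fun w => ?_⟩
  set c : ℝ := ⟪(e : H), w⟫ / ‖(e : H)‖ ^ 2 with hc
  set p : H := w - c • (e : H) with hp
  have hpe : ⟪(e : H), p⟫ = 0 := by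
    rw [hp, inner_sub_right, inner_smul_right, real_inner_self_eq_norm_sq, hc]
    field_simp
    ring
  have hperp : p ∈ Hplus := by
    have : p ∈ Hplusᗮᗮ := by
      rw [← h1.orth, Submodule.mem_orthogonal]
      intro z hz
      obtain ⟨a, ha⟩ := he ⟨z, hz⟩
      have ha' : z = a • (e : H) := by
        have := congrArg Subtype.val ha
        simpa using this.symm
      rw [ha', inner_smul_left, hpe]; simp
    rw [Submodule.orthogonal_orthogonal_eq_closure] at this
    rwa [h1.closed_plus.submodule_topologicalClosure_eq] at this
  have hPp : ⟪P p, (e : H)⟫ = 0 := by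
    have h := h1.inv_plus p hperp
    have hem : (e : H) ∈ Hplusᗮ := h1.orth ▸ e.2
    exact (Submodule.mem_orthogonal _ _).1 hem _ h
  have hPe : ⟪P (e : H), p⟫ = 0 := by
    have h := h1.inv_minus e e.2
    have hem : P (e : H) ∈ Hplusᗮ := h1.orth ▸ h
    rw [real_inner_comm]
    exact (Submodule.mem_orthogonal _ _).1 hem _ hperp
  have hVp : 0 ≤ ⟪P p, p⟫ := by
    by_cases h0 : p = 0
    · simp [h0]
    · exact (h1.pos p hperp h0).le
  have hw : w = p + c • (e : H) := by simp [hp]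
  have hV : ⟪P w, w⟫ = ⟪P p, p⟫ + c ^ 2 * ⟪P (e : H), (e : H)⟫ := by
    conv_lhs => rw [hw]
    simp only [map_add, map_smul, inner_add_left, inner_add_right, inner_smul_left,
      inner_smul_right, hPp, hPe]
    simp
    ring
  have : -⟪P (e : H), (e : H)⟫ / ‖(e : H)‖ ^ 4 * ⟪(e : H), w⟫ ^ 2
      = c ^ 2 * (-⟪P (e : H), (e : H)⟫) := by
    rw [hc]; field_simp
  rw [this, hV]
  linarith

theorem aux_diss {σ : ℝ} {ψ : ℝ → AddCircle σ → H → H} {P : H →L[ℝ] H} {δ ν : ℝ}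
    (h3 : HypH3 ψ P δ ν) {q : AddCircle σ} {u v : ℝ → H}
    (hu : IsCompleteTraj (circleFlow σ) ψ q u) (hv : IsCompleteTraj (circleFlow σ) ψ q v)
    (l r : ℝ) (hlr : l ≤ r) :
    Real.exp (2 * ν * r) * ⟪P (u r - v r), u r - v r⟫ -
      Real.exp (2 * ν * l) * ⟪P (u l - v l), u l - v l⟫ ≤
      -δ * ∫ s in l..r, Real.exp (2 * ν * s) * ‖u s - v s‖ ^ 2 := by
  obtain ⟨_, _, h⟩ := h3
  have h := h (circleFlow σ l q) (u l) (v l) 0 (r - l) le_rfl (by linarith)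
  have e1 : ∀ t, 0 ≤ t → ψ t (circleFlow σ l q) (u l) - ψ t (circleFlow σ l q) (v l)
      = u (t + l) - v (t + l) := fun t ht => by rw [hu.2 t l ht, hv.2 t l ht]
  rw [e1 _ (by linarith), e1 0 le_rfl] at h
  have e2 : ∫ s in (0:ℝ)..(r - l), Real.exp (2 * ν * s) *
        ‖ψ s (circleFlow σ l q) (u l) - ψ s (circleFlow σ l q) (v l)‖ ^ 2
      = Real.exp (-(2 * ν * l)) * ∫ s in l..r, Real.exp (2 * ν * s) * ‖u s - v s‖ ^ 2 := by
    rw [← intervalIntegral.integral_const_mul]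
    have := intervalIntegral.integral_comp_add_right (a := 0) (b := r - l)
      (fun s => Real.exp (-(2 * ν * l)) * (Real.exp (2 * ν * s) * ‖u s - v s‖ ^ 2)) l
    simp only [zero_add, sub_add_cancel] at this
    rw [← this]
    apply intervalIntegral.integral_congr
    intro s hs
    rw [uIcc_of_le (by linarith)] at hs
    simp only
    rw [e1 s hs.1, ← mul_assoc, ← Real.exp_add]
    congr 2
    ring
  rw [e2] at h
  simp only [sub_add_cancel, zero_add, mul_zero, Real.exp_zero, one_mul] at h
  have h' := mul_le_mul_of_nonneg_left h (Real.exp_pos (2 * ν * l)).le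
  have e3 : Real.exp (2 * ν * l) * Real.exp (2 * ν * (r - l)) = Real.exp (2 * ν * r) := by
    rw [← Real.exp_add]; congr 1; ring
  have e4 : Real.exp (2 * ν * l) * Real.exp (-(2 * ν * l)) = 1 := by
    rw [← Real.exp_add]; simp
  rw [mul_sub, ← mul_assoc, e3] at h'
  refine h'.trans (le_of_eq ?_)
  linear_combination (-δ * ∫ s in l..r, Real.exp (2 * ν * s) * ‖u s - v s‖ ^ 2) * e4

theorem aux_small {f : ℝ → ℝ} (hf : IntegrableOn f (Iic 0)) (ε : ℝ)
    (hε : 0 < ε) (L : ℝ) : ∃ l ≤ L, f l < ε := by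
  by_contra! hcon
  have hi : IntegrableOn f (Iic (min L 0)) := hf.mono_set (Iic_subset_Iic.2 (min_le_right _ _))
  have : IntegrableOn (fun _ : ℝ => ε) (Iic (min L 0)) := by
    refine Integrable.mono hi (by fun_prop) ?_
    filter_upwards [ae_restrict_mem measurableSet_Iic] with x hx
    have := hcon x (le_trans hx (min_le_left _ _))
    rw [Real.norm_of_nonneg hε.le, Real.norm_of_nonneg (by linarith)]
    exact this
  rw [integrableOn_const_iff] at this
  rcases this with h | h
  · simp at h; linarith
  · simp at h

theorem aux_shift_amen {ν : ℝ} {u : ℝ → H} (huc : Continuous u) (hu : IsAmenable ν u) (σ : ℝ) :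
    IsAmenable ν (fun t => u (t + σ)) := by
  have h0 : IntegrableOn (fun s : ℝ => Real.exp (2 * ν * s) * ‖u s‖ ^ 2) (Iic σ) := by
    have : IntegrableOn (fun s : ℝ => Real.exp (2 * ν * s) * ‖u s‖ ^ 2) (Icc 0 σ) :=
      Continuous.integrableOn_Icc (by fun_prop)
    refine (IntegrableOn.union hu this).mono_set ?_
    intro x hx
    rcases le_total x 0 with h | h
    · exact Or.inl h
    · exact Or.inr ⟨h, hx⟩
  have h1 := ((measurePreserving_add_right volume σ).integrableOn_comp_preimage
    (measurableEmbedding_addRight σ)).2 h0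
  have h2 : (fun x => x + σ) ⁻¹' Iic σ = Iic 0 := by ext; simp
  rw [h2] at h1
  have h3 := h1.const_mul (Real.exp (-(2 * ν * σ)))
  unfold IsAmenable
  refine h3.congr (ae_of_all _ fun s => ?_)
  simp only [Function.comp]
  rw [← mul_assoc, ← Real.exp_add]
  congr 2
  ring

theorem aux_key {σ : ℝ} {ψ : ℝ → AddCircle σ → H → H} {P : H →L[ℝ] H} {δ ν : ℝ}
    (h3 : HypH3 ψ P δ ν) {q : AddCircle σ} {u v : ℝ → H}
    (hu : IsCompleteTraj (circleFlow σ) ψ q u) (hv : IsCompleteTraj (circleFlow σ) ψ q v)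
    (hua : IsAmenable ν u) (hva : IsAmenable ν v)
    (a r : ℝ) (har : a ≤ r) :
    δ * ∫ s in a..r, Real.exp (2 * ν * s) * ‖u s - v s‖ ^ 2 ≤
      -(Real.exp (2 * ν * r) * ⟪P (u r - v r), u r - v r⟫) := by
  have hδ := h3.1
  have huc := hu.1
  have hvc := hv.1
  have hint : IntegrableOn (fun s => ‖P‖ * (2 * (Real.exp (2 * ν * s) * ‖u s‖ ^ 2) +
      2 * (Real.exp (2 * ν * s) * ‖v s‖ ^ 2))) (Iic 0) :=
    ((hua.const_mul 2).add (hva.const_mul 2)).const_mul _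
  apply le_of_forall_pos_le_add
  intro ε hε
  obtain ⟨l, hla, hl⟩ := aux_small hint ε hε a
  have hd := aux_diss h3 hu hv l r (hla.trans har)
  have hVl : Real.exp (2 * ν * l) * ⟪P (u l - v l), u l - v l⟫ ≤ ‖P‖ * (2 * (Real.exp (2 * ν * l) * ‖u l‖ ^ 2) +
      2 * (Real.exp (2 * ν * l) * ‖v l‖ ^ 2)) := by
    have i1 : ⟪P (u l - v l), u l - v l⟫ ≤ ‖P‖ * ‖u l - v l‖ ^ 2 := by
      refine (real_inner_le_norm _ _).trans ?_
      rw [sq, ← mul_assoc]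
      gcongr
      exact P.le_opNorm _
    have i2 : ‖u l - v l‖ ^ 2 ≤ 2 * ‖u l‖ ^ 2 + 2 * ‖v l‖ ^ 2 := by
      have := norm_sub_le (u l) (v l)
      have h2 : ‖u l - v l‖ ^ 2 ≤ (‖u l‖ + ‖v l‖) ^ 2 := by gcongr
      nlinarith [sq_nonneg (‖u l‖ - ‖v l‖)]
    have i3 := i1.trans (mul_le_mul_of_nonneg_left i2 (norm_nonneg P))
    have i4 := mul_le_mul_of_nonneg_left i3 (Real.exp_pos (2 * ν * l)).le
    linarith
  have hsplit := intervalIntegral.integral_add_adjacent_intervals (μ := volume) (a := l) (b := a) (c := r)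
    (f := fun s => Real.exp (2 * ν * s) * ‖u s - v s‖ ^ 2)
    (Continuous.intervalIntegrable (by fun_prop) _ _)
    (Continuous.intervalIntegrable (by fun_prop) _ _)
  have hnn : 0 ≤ ∫ s in l..a, Real.exp (2 * ν * s) * ‖u s - v s‖ ^ 2 :=
    intervalIntegral.integral_nonneg hla (fun s _ => by positivity)
  rw [← hsplit] at hd
  nlinarith [mul_nonneg hδ.le hnn]

/-- A monotone-type summability criterion. -/
theorem aux_summable {x : ℕ → ℝ} {M : ℝ} (hM : ∀ k, |x k| ≤ M)
    (h : (∀ k, 0 ≤ x (k + 1) - x k) ∨ (∀ k, x (k + 1) - x k ≤ 0)) :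
    Summable (fun k => |x (k + 1) - x k|) := by
  refine summable_of_sum_range_le (c := 2 * M) (fun _ => abs_nonneg _) fun n => ?_
  have h0 := abs_le.1 (hM 0)
  have hn := abs_le.1 (hM n)
  rcases h with h | h
  · rw [Finset.sum_congr rfl (fun k _ => abs_of_nonneg (h k)), Finset.sum_range_sub]
    linarith
  · rw [Finset.sum_congr rfl (fun k _ => abs_of_nonpos (h k)), Finset.sum_neg_distrib,
      Finset.sum_range_sub]
    linarith

/-- L² smallness with summable bounds gives a point where the sequence converges. -/
theorem aux_ae {w : ℕ → ℝ → H} (hw : ∀ k, Continuous (w k)) {C : ℝ} {c : ℕ → ℝ}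
    (hc0 : ∀ k, 0 ≤ c k) (hc : Summable c) (hC : 0 ≤ C)
    (hb : ∀ k, ∫ s in (-1:ℝ)..0, ‖w k s‖ ^ 2 ≤ C * c k ^ 2) :
    ∃ s : ℝ, Summable (fun k => ‖w k s‖) := by
  set c' : ℕ → ℝ := fun k => c k + (1 / 2) ^ k with hc'
  have hc's : Summable c' := hc.add summable_geometric_two
  have hc'pos : ∀ k, 0 < c' k := fun k => by
    have := hc0 k
    simp only [hc']; positivity
  have hI : ∀ k, ∫ s in (-1:ℝ)..0, ‖w k s‖ ≤ (C + 1) * c' k := by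
    intro k
    have hwk := hw k
    have hp := hc'pos k
    have h1 : ∫ s in (-1:ℝ)..0, ‖w k s‖ ≤ ∫ s in (-1:ℝ)..0, ((c' k)⁻¹ * ‖w k s‖ ^ 2 + c' k) := by
      apply intervalIntegral.integral_mono_on (by norm_num)
        (Continuous.intervalIntegrable (by fun_prop) _ _)
        (Continuous.intervalIntegrable (by fun_prop) _ _)
      intro s _
      have : ‖w k s‖ * c' k ≤ ‖w k s‖ ^ 2 + c' k * c' k := by
        nlinarith [sq_nonneg (‖w k s‖ - c' k), sq_nonneg (‖w k s‖), sq_nonneg (c' k)]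
      have h2 : ‖w k s‖ ≤ (‖w k s‖ ^ 2 + c' k * c' k) / c' k := by
        rwa [le_div_iff₀ hp]
      refine h2.trans (le_of_eq ?_)
      field_simp
    rw [intervalIntegral.integral_add (Continuous.intervalIntegrable (by fun_prop) _ _)
      (Continuous.intervalIntegrable (by fun_prop) _ _), intervalIntegral.integral_const_mul] at h1
    simp only [intervalIntegral.integral_const, sub_neg_eq_add, zero_add, one_smul] at h1
    have h2 : (c' k)⁻¹ * ∫ s in (-1:ℝ)..0, ‖w k s‖ ^ 2 ≤ C * c' k := by
      rw [inv_mul_le_iff₀ hp]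
      refine (hb k).trans ?_
      have : c k ≤ c' k := by simp only [hc']; simp
      have h3 : c k ^ 2 ≤ c' k ^ 2 := by
        have := hc0 k
        gcongr
      nlinarith
    linarith
  have hL : ∀ k, ∫⁻ s in Ioc (-1:ℝ) 0, ENNReal.ofReal ‖w k s‖ ≤ ENNReal.ofReal ((C + 1) * c' k) := by
    intro k
    have hwk := hw k
    rw [← ofReal_integral_eq_lintegral_ofReal, ← intervalIntegral.integral_of_le (by norm_num)]
    · exact ENNReal.ofReal_le_ofReal (hI k)
    · exact (Continuous.integrableOn_Icc (by fun_prop)).mono_set Ioc_subset_Icc_self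
    · exact ae_of_all _ fun _ => norm_nonneg _
  have hmeas : ∀ k, Measurable fun s => ENNReal.ofReal ‖w k s‖ := fun k =>
    (ENNReal.continuous_ofReal.comp (hw k).norm).measurable
  have hfin : ∫⁻ s in Ioc (-1:ℝ) 0, ∑' k, ENNReal.ofReal ‖w k s‖ ≠ ⊤ := by
    rw [lintegral_tsum (fun k => (hmeas k).aemeasurable)]
    refine ne_top_of_le_ne_top ?_ (ENNReal.tsum_le_tsum hL)
    exact (hc's.mul_left (C + 1)).tsum_ofReal_ne_top
  have hae := ae_lt_top (Measurable.ennreal_tsum hmeas) hfin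
  have hne : (volume.restrict (Ioc (-1:ℝ) 0)) ≠ 0 := by
    rw [Ne, Measure.restrict_eq_zero]; simp
  have : NeBot (ae (volume.restrict (Ioc (-1:ℝ) 0))) := ae_neBot.2 hne
  obtain ⟨s, hs⟩ := hae.exists
  refine ⟨s, ?_⟩
  have := ENNReal.summable_toReal hs.ne
  simpa using this

theorem aux_cont {σ : ℝ} {ψ : ℝ → AddCircle σ → H → H} (hcoc : IsCocycle (circleFlow σ) ψ)
    (q : AddCircle σ) : ContinuousOn (fun p : H × ℝ => ψ p.2 q p.1) (univ ×ˢ Ici 0) := by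
  have : ContinuousOn ((fun p : ℝ × AddCircle σ × H => ψ p.1 p.2.1 p.2.2) ∘
      (fun p : H × ℝ => (p.2, q, p.1))) (univ ×ˢ Ici 0) := by
    refine hcoc.2.2.comp (by fun_prop) ?_
    intro p hp
    exact hp.2
  exact this

theorem aux_sign {d : ℝ → ℝ} (hd : Continuous d) (h : ∀ a b, a ≤ b → d a = 0 → d b = 0) :
    (∀ t, 0 ≤ d t) ∨ (∀ t, d t ≤ 0) := by
  by_contra! hcon
  obtain ⟨⟨i, hi⟩, ⟨j, hj⟩⟩ := hcon
  have hz : (0:ℝ) ∈ uIcc (d i) (d j) := by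
    rw [uIcc_of_le (by linarith)]; exact ⟨hi.le, hj.le⟩
  obtain ⟨t, ht, ht0⟩ := intermediate_value_uIcc hd.continuousOn hz
  rcases le_total i j with hij | hij
  · rw [uIcc_of_le hij] at ht
    have := h t j ht.2 ht0
    linarith
  · rw [uIcc_of_ge hij] at ht
    have := h t i ht.2 ht0
    linarith

end Aux

/-- Lemma 5, item 1: for a σ-periodic cocycle under (H1), (H2) with `j = 1` and (H3),
every amenable complete trajectory bounded in the future converges (as `t → +∞`) to a
σ-periodic trajectory at the same `q`. -/
theorem amenable_bounded_future_converges_to_periodic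
    {H : Type*} [NormedAddCommGroup H] [InnerProductSpace ℝ H]
    [CompleteSpace H] [TopologicalSpace.SeparableSpace H]
    (σ : ℝ) (hσ : 0 < σ)
    (ψ : ℝ → AddCircle σ → H → H)
    (hcoc : IsCocycle (circleFlow σ) ψ)
    (P : H →L[ℝ] H) (Hplus Hminus : Submodule ℝ H)
    (h1 : HypH1 P Hplus Hminus)
    (h2 : HypH2 Hminus 1)
    (δ ν : ℝ) (h3 : HypH3 ψ P δ ν)
    (q : AddCircle σ) (u : ℝ → H)
    (hu : IsCompleteTraj (circleFlow σ) ψ q u) (hua : IsAmenable ν u)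
    (hbdd : IsBounded (u '' Set.Ici (0:ℝ))) :
    ∃ v : ℝ → H, IsCompleteTraj (circleFlow σ) ψ q v ∧ (∀ t : ℝ, v (t + σ) = v t) ∧
      Tendsto (fun t : ℝ => u t - v t) atTop (𝓝 0) := by
  obtain ⟨e, K, hK, hlow⟩ := aux_lower_bound P Hplus Hminus h1 h2
  have hδ := h3.1
  have hν := h3.2.1
  have huc := hu.1
  -- the flow is periodic
  have hper : ∀ (k : ℕ) (s : ℝ), circleFlow σ (s + k * σ) q = circleFlow σ s q := by
    intro k s
    have : ((k * σ : ℝ) : AddCircle σ) = 0 := by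
      rw [AddCircle.coe_eq_zero_iff]
      exact ⟨k, by simp⟩
    simp only [circleFlow, AddCircle.coe_add, this, add_zero]
  have htr : ∀ k : ℕ, IsCompleteTraj (circleFlow σ) ψ q (fun t => u (t + k * σ)) := by
    intro k
    refine ⟨by fun_prop, fun t s ht => ?_⟩
    simp only
    rw [add_assoc, hu.2 t _ ht, hper]
  have hu1 : IsCompleteTraj (circleFlow σ) ψ q (fun t => u (t + σ)) := by
    simpa using htr 1
  have hu1a : IsAmenable ν (fun t => u (t + σ)) := aux_shift_amen huc hua σ
  set w : ℝ → H := fun t => u (t + σ) - u t with hw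
  have hwc : Continuous w := by fun_prop
  set d : ℝ → ℝ := fun t => ⟪e, w t⟫ with hd
  have hdc : Continuous d := by fun_prop
  have hkey : ∀ a r, a ≤ r → δ * ∫ s in a..r, Real.exp (2 * ν * s) * ‖w s‖ ^ 2 ≤
      Real.exp (2 * ν * r) * (K * d r ^ 2) := by
    intro a r har
    have k1 := aux_key h3 hu1 hu hu1a hua a r har
    refine k1.trans ?_
    have k2 := mul_le_mul_of_nonneg_left (hlow (w r)) (Real.exp_pos (2 * ν * r)).le
    simp only [hw, hd] at k2 ⊢
    linarith
  have hzero : ∀ a b, a ≤ b → d a = 0 → d b = 0 := by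
    intro a b hab h0
    have hwa : w a = 0 := by
      by_contra hne
      have hpos : 0 < ∫ s in (a - 1)..a, Real.exp (2 * ν * s) * ‖w s‖ ^ 2 := by
        apply intervalIntegral.integral_pos (by linarith)
        · exact Continuous.continuousOn (by fun_prop)
        · intro x _; positivity
        · refine ⟨a, ⟨by linarith, le_rfl⟩, ?_⟩
          have : 0 < ‖w a‖ := norm_pos_iff.2 hne
          positivity
      have := hkey (a - 1) a (by linarith)
      rw [h0] at this
      have h' := mul_pos hδ hpos
      simp at this
      linarith
    have e1 := hu1.2 (b - a) a (by linarith)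
    have e2 := hu.2 (b - a) a (by linarith)
    simp only [sub_add_cancel] at e1 e2
    have e3 : u (a + σ) = u a := sub_eq_zero.1 hwa
    have : w b = 0 := by
      simp only [hw]
      rw [e1, e2, e3, sub_self]
    simp [hd, this]
  have hsign := aux_sign hdc hzero
  obtain ⟨M, hM⟩ := hbdd.exists_norm_le
  have hMk : ∀ k : ℕ, |⟪e, u (k * σ)⟫| ≤ ‖e‖ * M := by
    intro k
    refine (abs_real_inner_le_norm _ _).trans ?_
    gcongr
    exact hM _ ⟨_, by simp only [mem_Ici]; positivity, rfl⟩
  have hdk : ∀ k : ℕ, ⟪e, u ((k + 1 : ℕ) * σ)⟫ - ⟪e, u (k * σ)⟫ = d (k * σ) := by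
    intro k
    simp only [hd, hw, inner_sub_right]
    congr 3
    push_cast; ring_nf
  have hsum : Summable (fun k : ℕ => |d (k * σ)|) := by
    have := aux_summable hMk (by
      rcases hsign with h | h
      · exact Or.inl fun k => by rw [hdk]; exact h _
      · exact Or.inr fun k => by rw [hdk]; exact h _)
    simpa only [hdk] using this
  obtain ⟨s₀, hs₀⟩ := aux_ae (w := fun (k : ℕ) s => w (s + k * σ)) (fun k => by fun_prop)
    (C := Real.exp (2 * ν) * K / δ) (c := fun k : ℕ => |d (k * σ)|) (fun k => abs_nonneg _)
    hsum (by positivity) (by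
      intro k
      have := hkey (k * σ - 1) (k * σ) (by linarith)
      have e1 := intervalIntegral.integral_comp_add_right (a := -1) (b := 0)
        (fun s => ‖w s‖ ^ 2) (k * σ)
      rw [e1, sq_abs, zero_add, neg_add_eq_sub]
      have e2 : Real.exp (2 * ν * (k * σ - 1)) * ∫ s in (k * σ - 1)..(k * σ), ‖w s‖ ^ 2
          ≤ ∫ s in (k * σ - 1)..(k * σ), Real.exp (2 * ν * s) * ‖w s‖ ^ 2 := by
        rw [← intervalIntegral.integral_const_mul]
        apply intervalIntegral.integral_mono_on (by linarith)
          (Continuous.intervalIntegrable (by fun_prop) _ _)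
          (Continuous.intervalIntegrable (by fun_prop) _ _)
        intro s hs
        have := hs.1
        gcongr
      have e3 : Real.exp (2 * ν * (k * σ)) = Real.exp (2 * ν * (k * σ - 1)) * Real.exp (2 * ν) := by
        rw [← Real.exp_add]; congr 1; ring
      have e4 := (mul_le_mul_of_nonneg_left e2 hδ.le).trans this
      rw [e3] at e4
      have hE := Real.exp_pos (2 * ν * (k * σ - 1))
      have e5 : δ * ∫ s in (k * σ - 1)..(k * σ), ‖w s‖ ^ 2 ≤ Real.exp (2 * ν) * K * d (k * σ) ^ 2 := by
        refine le_of_mul_le_mul_left ?_ hE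
        linarith
      rw [div_mul_eq_mul_div, le_div_iff₀ hδ]
      linarith)
  -- convergence of the shifted trajectories at every time
  have hconv0 : ∃ a, Tendsto (fun k : ℕ => u (s₀ + k * σ)) atTop (𝓝 a) := by
    refine cauchySeq_tendsto_of_complete (cauchySeq_of_summable_dist ?_)
    refine hs₀.congr fun k => ?_
    rw [dist_comm, dist_eq_norm]
    simp only [hw]
    congr 3
    push_cast; ring
  have hcu : ∀ (q' : AddCircle σ) (t : ℝ), 0 ≤ t → Continuous (fun x => ψ t q' x) := by
    intro q' t ht
    have h := (aux_cont hcoc q').comp (f := fun x : H => (x, t)) (s := univ) (by fun_prop)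
      (fun x _ => ⟨mem_univ _, ht⟩)
    exact continuousOn_univ.1 h
  have hconv1 : ∀ t, s₀ ≤ t → ∃ a, Tendsto (fun k : ℕ => u (t + k * σ)) atTop (𝓝 a) := by
    intro t ht
    obtain ⟨a, ha⟩ := hconv0
    refine ⟨ψ (t - s₀) (circleFlow σ s₀ q) a, ?_⟩
    refine (((hcu (circleFlow σ s₀ q) (t - s₀) (by linarith)).tendsto a).comp ha).congr fun k => ?_
    have := (htr k).2 (t - s₀) s₀ (by linarith)
    simp only [sub_add_cancel] at this
    exact this.symm
  have hconv : ∀ t, ∃ a, Tendsto (fun k : ℕ => u (t + k * σ)) atTop (𝓝 a) := by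
    intro t
    obtain ⟨m, hm⟩ := exists_nat_ge ((s₀ - t) / σ)
    rw [div_le_iff₀ hσ] at hm
    obtain ⟨a, ha⟩ := hconv1 (t + m * σ) (by linarith)
    refine ⟨a, (tendsto_add_atTop_iff_nat m).1 (ha.congr fun k => ?_)⟩
    congr 1
    push_cast; ring
  choose v hv using hconv
  have hvtraj : ∀ t s : ℝ, 0 ≤ t → v (t + s) = ψ t (circleFlow σ s q) (v s) := by
    intro t s ht
    refine tendsto_nhds_unique (hv (t + s)) ?_
    refine (((hcu (circleFlow σ s q) t ht).tendsto (v s)).comp (hv s)).congr fun k => ?_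
    exact ((htr k).2 t s ht).symm
  have hvc : Continuous v := by
    rw [continuous_iff_continuousAt]
    intro t
    have h := (aux_cont hcoc (circleFlow σ (t - 1) q)).comp
      (f := fun x : ℝ => (v (t - 1), x - (t - 1))) (s := Ici (t - 1)) (by fun_prop)
      (fun x hx => ⟨mem_univ _, by simpa using hx⟩)
    have h' : ContinuousOn v (Ici (t - 1)) := by
      refine h.congr fun x hx => ?_
      have := hvtraj (x - (t - 1)) (t - 1) (by simpa using hx)
      rw [sub_add_cancel] at this
      exact this
    exact h'.continuousAt (Ici_mem_nhds (by linarith))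
  have hvper : ∀ t : ℝ, v (t + σ) = v t := by
    intro t
    refine tendsto_nhds_unique (hv (t + σ)) ?_
    refine ((tendsto_add_atTop_iff_nat 1).2 (hv t)).congr fun k => ?_
    congr 1
    push_cast; ring
  refine ⟨v, ⟨hvc, hvtraj⟩, hvper, ?_⟩
  have hvperk : ∀ (k : ℕ) (t : ℝ), v (t + k * σ) = v t := by
    intro k
    induction k with
    | zero => intro t; simp
    | succ k ih =>
      intro t
      rw [← ih t, ← hvper (t + k * σ)]
      congr 1
      push_cast; ring
  have hq0 : circleFlow σ 0 q = q := by simp [circleFlow]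
  rw [Metric.tendsto_atTop]
  intro ε hε
  obtain ⟨U, hU, hUε⟩ := IsCompact.mem_uniformity_of_prod (f := fun (x : H) (t : ℝ) => ψ t q x)
    (s := univ) (k := Icc 0 σ) (q := v 0) isCompact_Icc
    ((aux_cont hcoc q).mono (prod_mono_right Icc_subset_Ici_self)) (mem_univ _)
    (Metric.dist_mem_uniformity hε)
  rw [nhdsWithin_univ] at hU
  obtain ⟨N, hN⟩ := eventually_atTop.1 ((hv 0).eventually hU)
  refine ⟨N * σ, fun t ht => ?_⟩
  have ht0 : 0 ≤ t := le_trans (by positivity) ht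
  set k := ⌊t / σ⌋₊ with hk
  have hk1 : k * σ ≤ t := by
    rw [← le_div_iff₀ hσ]; exact Nat.floor_le (by positivity)
  have hk2 : t < (k + 1) * σ := by
    rw [← div_lt_iff₀ hσ]; exact Nat.lt_floor_add_one _
  have hkN : N ≤ k := Nat.le_floor (by rw [le_div_iff₀ hσ]; exact ht)
  have hfin := hUε _ (hN k hkN) (t - k * σ) ⟨by linarith, by linarith⟩
  have e1 := (htr k).2 (t - k * σ) 0 (by linarith)
  have e2 := hvtraj (t - k * σ) 0 (by linarith)
  rw [hq0] at e1 e2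
  simp only [add_zero] at e2
  simp only [add_zero, sub_add_cancel] at e1
  have e3 := hvperk k (t - k * σ)
  rw [sub_add_cancel] at e3
  simp only [mem_setOf_eq] at hfin
  rw [← e1, ← e2, ← e3] at hfin
  rwa [dist_zero_right, ← dist_eq_norm]
end
end

section
/- Suppose the cocycle (ψ,ϑ) is σ-periodic and (H1), (H2) with j = 1, (H3) and at least one of (COM1) or (COM2) hold. Then every amenable stable σ-periodic trajectory is Lyapunov stable. -/
open MeasureTheory Set Bornology Filter Topology RealInnerProductSpace

noncomputable section

variable {Q H : Type*}

/-- An amenable trajectory `v` at `q` is amenable stable if amenable trajectories starting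
close to `v(0)` remain close to `v` for all `t ≥ 0`. -/
def AmenableStable {Q H : Type*} [MetricSpace Q] [NormedAddCommGroup H]
    [InnerProductSpace ℝ H] (ϑ : ℝ → Q → Q) (ψ : ℝ → Q → H → H) (ν : ℝ) (q : Q)
    (v : ℝ → H) : Prop :=
  ∀ ε > (0:ℝ), ∃ η > (0:ℝ), ∀ u : ℝ → H, IsCompleteTraj ϑ ψ q u → IsAmenable ν u →
    ‖u 0 - v 0‖ < η → ∀ t ≥ (0:ℝ), ‖u t - v t‖ < ε


section Aux
variable {E : Type*} [NormedAddCommGroup E] [InnerProductSpace ℝ E]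

/-- The quadratic form of `P`. -/
def quadV (P : E →L[ℝ] E) (x : E) : ℝ := ⟪P x, x⟫

/-- `u` is a trajectory of the process `U` on `[a, ∞)`. -/
def TrajFrom (U : ℝ → ℝ → E → E) (a : ℝ) (u : ℝ → E) : Prop :=
  ∀ s, a ≤ s → ∀ t, 0 ≤ t → u (t + s) = U t s (u s)

/-- The data of a periodic process, rewritten over the real line. -/
structure Sys (U : ℝ → ℝ → E → E) (v : ℝ → E) (P : E →L[ℝ] E) (e : E) (c δ ν σ : ℝ) : Prop where
  cont : Continuous fun p : ℝ × ℝ × E => U p.1 p.2.1 p.2.2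
  zero : ∀ s x, U 0 s x = x
  comp : ∀ t r, 0 ≤ t → 0 ≤ r → ∀ s x, U (t + r) s x = U t (r + s) (U r s x)
  per : ∀ t s x, U t (s + σ) x = U t s x
  spos : 0 < σ
  dpos : 0 < δ
  npos : 0 < ν
  cpos : 0 < c
  diss : ∀ s x y r, 0 ≤ r →
    Real.exp (2 * ν * r) * quadV P (U r s x - U r s y) - quadV P (x - y) ≤
      -δ * ∫ τ in (0:ℝ)..r, Real.exp (2 * ν * τ) * ‖U τ s x - U τ s y‖ ^ 2
  vcont : Continuous v
  vtraj : ∀ s t, 0 ≤ t → v (t + s) = U t s (v s)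
  vper : ∀ t, v (t + σ) = v t
  lower : ∀ x, -c * ⟪e, x⟫ ^ 2 ≤ quadV P x
  onE : ∀ s : ℝ, quadV P (s • e) = -c * s ^ 2
  unit : ‖e‖ = 1

lemma quadV_cont (P : E →L[ℝ] E) : Continuous (quadV P) := by
  unfold quadV; fun_prop

lemma quadV_le (P : E →L[ℝ] E) (x : E) : quadV P x ≤ ‖P‖ * ‖x‖ ^ 2 := by
  unfold quadV
  calc ⟪P x, x⟫ ≤ ‖P x‖ * ‖x‖ := real_inner_le_norm _ _
    _ ≤ (‖P‖ * ‖x‖) * ‖x‖ := by gcongr; exact P.le_opNorm x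
    _ = _ := by ring

lemma quadV_zero (P : E →L[ℝ] E) : quadV P 0 = 0 := by simp [quadV]

lemma quadV_neg (P : E →L[ℝ] E) (x : E) : quadV P (-x) = quadV P x := by simp [quadV]

lemma quadV_sub_comm (P : E →L[ℝ] E) (x y : E) : quadV P (x - y) = quadV P (y - x) := by
  rw [← quadV_neg, neg_sub]

namespace Sys
variable {U : ℝ → ℝ → E → E} {v : ℝ → E} {P : E →L[ℝ] E} {e : E} {c δ ν σ : ℝ}

lemma negE (S : Sys U v P e c δ ν σ) : Sys U v P (-e) c δ ν σ where
  __ := S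
  lower := fun x => by simpa using S.lower x
  onE := fun s => by
    have := S.onE (-s)
    simpa using this
  unit := by simpa using S.unit

lemma traj_eq (_S : Sys U v P e c δ ν σ) {a : ℝ} {u : ℝ → E} (hu : TrajFrom U a u) {s t : ℝ}
    (hs : a ≤ s) (ht : s ≤ t) : u t = U (t - s) s (u s) := by
  have := hu s hs (t - s) (by linarith)
  simpa using this

lemma traj_contOn (S : Sys U v P e c δ ν σ) {a : ℝ} {u : ℝ → E} (hu : TrajFrom U a u) :
    ContinuousOn u (Ici a) := by
  have h : Continuous fun t => U (t - a) a (u a) :=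
    S.cont.comp (f := fun t : ℝ => (t - a, a, u a)) (by fun_prop)
  exact h.continuousOn.congr fun t ht => S.traj_eq hu le_rfl ht

lemma vTraj (S : Sys U v P e c δ ν σ) (a : ℝ) : TrajFrom U a v :=
  fun s _ t ht => S.vtraj s t ht

/-- (H3) for two trajectories. -/
lemma diss' (S : Sys U v P e c δ ν σ) {a l r : ℝ} {u w : ℝ → E} (hu : TrajFrom U a u)
    (hw : TrajFrom U a w) (hal : a ≤ l) (hlr : l ≤ r) :
    δ * (∫ s in l..r, Real.exp (2 * ν * s) * ‖u s - w s‖ ^ 2) ≤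
      Real.exp (2 * ν * l) * quadV P (u l - w l) - Real.exp (2 * ν * r) * quadV P (u r - w r) := by
  have h := S.diss l (u l) (w l) (r - l) (by linarith)
  rw [← S.traj_eq hu hal hlr, ← S.traj_eq hw hal hlr] at h
  have e1 : (∫ s in l..r, Real.exp (2 * ν * s) * ‖u s - w s‖ ^ 2) =
      Real.exp (2 * ν * l) * ∫ τ in (0:ℝ)..(r - l),
        Real.exp (2 * ν * τ) * ‖U τ l (u l) - U τ l (w l)‖ ^ 2 := by
    have := intervalIntegral.integral_comp_add_right (a := 0) (b := r - l)
      (fun s => Real.exp (2 * ν * s) * ‖u s - w s‖ ^ 2) l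
    simp only [zero_add, sub_add_cancel] at this
    rw [← this, ← intervalIntegral.integral_const_mul]
    apply intervalIntegral.integral_congr
    intro τ hτ
    rw [uIcc_of_le (by linarith)] at hτ
    simp only
    rw [hu l hal τ hτ.1, hw l hal τ hτ.1, ← mul_assoc, ← Real.exp_add]
    ring_nf
  have e2 : Real.exp (2 * ν * r) = Real.exp (2 * ν * l) * Real.exp (2 * ν * (r - l)) := by
    rw [← Real.exp_add]; ring_nf
  rw [e1, e2]
  have := mul_le_mul_of_nonneg_left h (Real.exp_pos (2 * ν * l)).le
  linarith

lemma int_nonneg {l r : ℝ} (hlr : l ≤ r) (ν : ℝ) (f : ℝ → E) :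
    0 ≤ ∫ s in l..r, Real.exp (2 * ν * s) * ‖f s‖ ^ 2 :=
  intervalIntegral.integral_nonneg hlr fun s _ => by positivity

lemma mono (S : Sys U v P e c δ ν σ) {a l r : ℝ} {u w : ℝ → E} (hu : TrajFrom U a u)
    (hw : TrajFrom U a w) (hal : a ≤ l) (hlr : l ≤ r) :
    Real.exp (2 * ν * r) * quadV P (u r - w r) ≤ Real.exp (2 * ν * l) * quadV P (u l - w l) := by
  have h := S.diss' hu hw hal hlr
  have := mul_nonneg S.dpos.le (int_nonneg hlr ν (fun s => u s - w s))
  linarith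

lemma neg_of_neg (S : Sys U v P e c δ ν σ) {a l r : ℝ} {u w : ℝ → E} (hu : TrajFrom U a u)
    (hw : TrajFrom U a w) (hal : a ≤ l) (hlr : l ≤ r) (h : quadV P (u l - w l) < 0) :
    quadV P (u r - w r) < 0 := by
  have h1 := S.mono hu hw hal hlr
  have h2 := mul_neg_of_pos_of_neg (Real.exp_pos (2 * ν * l)) h
  exact neg_of_mul_neg_right (h1.trans_lt h2) (Real.exp_pos _).le

/-- In the negative cone, the order of the projections is preserved. -/
lemma order (S : Sys U v P e c δ ν σ) {a t : ℝ} {u w : ℝ → E} (hu : TrajFrom U a u)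
    (hw : TrajFrom U a w) (hat : a ≤ t) (h : quadV P (u a - w a) < 0)
    (hpos : 0 < ⟪e, u a - w a⟫) : 0 < ⟪e, u t - w t⟫ := by
  by_contra! hneg
  have hc : ContinuousOn (fun s => ⟪e, u s - w s⟫) (Icc a t) := by
    have h1 := (S.traj_contOn hu).mono (fun x (hx : x ∈ Icc a t) => hx.1)
    have h2 := (S.traj_contOn hw).mono (fun x (hx : x ∈ Icc a t) => hx.1)
    exact continuousOn_const.inner (h1.sub h2)
  obtain ⟨s, hs, hs0⟩ := intermediate_value_Icc' hat hc ⟨hneg, hpos.le⟩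
  have h3 := S.neg_of_neg hu hw le_rfl hs.1 h
  have h4 := S.lower (u s - w s)
  simp only at hs0
  rw [hs0] at h4
  simp at h4
  linarith

/-- Uniform continuity near the periodic trajectory. -/
lemma unif (S : Sys U v P e c δ ν σ) {ε : ℝ} (hε : 0 < ε) :
    ∃ η > 0, ∀ s t x, 0 ≤ t → t ≤ 1 → ‖x - v s‖ < η → ‖U t s x - v (t + s)‖ < ε := by
  have hK : IsCompact ((Icc (0:ℝ) 1) ×ˢ (Icc (0:ℝ) σ)) := isCompact_Icc.prod isCompact_Icc
  have hg : Continuous fun z : E × (ℝ × ℝ) =>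
      ‖U z.2.1 z.2.2 (v z.2.2 + z.1) - v (z.2.1 + z.2.2)‖ := by
    have hv := S.vcont
    have := S.cont.comp (f := fun z : E × (ℝ × ℝ) => (z.2.1, z.2.2, v z.2.2 + z.1)) (by fun_prop)
    have h2 : Continuous fun z : E × (ℝ × ℝ) => U z.2.1 z.2.2 (v z.2.2 + z.1) := this
    exact (h2.sub (by fun_prop)).norm
  have key := hK.eventually_forall_of_forall_eventually (x₀ := (0:E))
    (P := fun x p => ‖U p.1 p.2 (v p.2 + x) - v (p.1 + p.2)‖ < ε) (by
      rintro ⟨t, s⟩ ⟨ht, hs⟩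
      refine hg.continuousAt.eventually (gt_mem_nhds ?_)
      simp only [add_zero]
      rw [← S.vtraj s t ht.1]
      simpa using hε)
  obtain ⟨η, hη, H⟩ := Metric.eventually_nhds_iff.1 key
  refine ⟨η, hη, fun s t x ht0 ht1 hx => ?_⟩
  have hper : Function.Periodic (fun s => (v s, v (t + s), fun x => U t s x)) σ := by
    intro s
    simp only [S.vper, ← add_assoc, S.per]
  obtain ⟨y, hy, hyeq⟩ := hper.exists_mem_Ico₀ S.spos s
  simp only [Prod.mk.injEq] at hyeq
  obtain ⟨h1, h2, h3⟩ := hyeq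
  have := H (y := x - v s) (by simpa using hx) (t, y) ⟨⟨ht0, ht1⟩, ⟨hy.1, hy.2.le⟩⟩
  simp only [← h1, ← h2, ← congrFun h3, add_sub_cancel] at this
  exact this

lemma small (S : Sys U v P e c δ ν σ) {ε : ℝ} (hε : 0 < ε) :
    ∃ ρ > 0, ∀ a r u, TrajFrom U a u → a ≤ r - 1 →
      Real.exp (2 * ν * (r - 1)) * quadV P (u (r - 1) - v (r - 1)) ≤
        Real.exp (2 * ν * (r - 1)) * ρ →
      -ρ ≤ quadV P (u r - v r) → ‖u r - v r‖ < ε := by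
  obtain ⟨η, hη, H⟩ := S.unif hε
  have hd := S.dpos
  refine ⟨δ * η ^ 2 / (2 * (1 + Real.exp (2 * ν))), by positivity, fun a r u hu har h1 h2 => ?_⟩
  set ρ := δ * η ^ 2 / (2 * (1 + Real.exp (2 * ν))) with hρ
  by_contra! hbig
  have hge : ∀ s ∈ Icc (r - 1) r, η ≤ ‖u s - v s‖ := by
    intro s hs
    by_contra! hlt
    have := H s (r - s) (u s) (by linarith [hs.2]) (by linarith [hs.1]) hlt
    rw [sub_add_cancel, ← S.traj_eq hu (har.trans hs.1) hs.2] at this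
    linarith
  have hdis := S.diss' hu (S.vTraj a) har (by linarith : r - 1 ≤ r)
  have hlow : Real.exp (2 * ν * (r - 1)) * η ^ 2 ≤
      ∫ s in (r-1)..r, Real.exp (2 * ν * s) * ‖u s - v s‖ ^ 2 := by
    have hm : ∫ s in (r-1)..r, Real.exp (2 * ν * (r - 1)) * η ^ 2 ≤
      ∫ s in (r-1)..r, Real.exp (2 * ν * s) * ‖u s - v s‖ ^ 2 := by
      apply intervalIntegral.integral_mono_on (by linarith) (by simp)
      · apply ContinuousOn.intervalIntegrable
        rw [uIcc_of_le (by linarith)]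
        have h1 := (S.traj_contOn hu).mono
          (fun x (hx : x ∈ Icc (r - 1) r) => har.trans hx.1)
        have h2 := S.vcont.continuousOn (s := Icc (r-1) r)
        fun_prop
      · intro s hs
        have := S.npos
        have := hge s hs
        have := hs.1
        gcongr
    simpa using hm
  have hexp : Real.exp (2 * ν * r) = Real.exp (2 * ν * (r - 1)) * Real.exp (2 * ν) := by
    rw [← Real.exp_add]; ring_nf
  rw [hexp] at hdis
  have hep := Real.exp_pos (2 * ν * (r - 1))
  have hep2 := Real.exp_pos (2 * ν)
  have h3 := mul_le_mul_of_nonneg_left hlow hd.le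
  have h4 := mul_le_mul_of_nonneg_left h2 (mul_pos hep hep2).le
  have h5 : δ * (Real.exp (2 * ν * (r - 1)) * η ^ 2) ≤
      Real.exp (2 * ν * (r - 1)) * (ρ * (1 + Real.exp (2 * ν))) := by linarith
  have h6 : ρ * (1 + Real.exp (2 * ν)) = δ * η ^ 2 / 2 := by rw [hρ]; field_simp
  rw [h6] at h5
  have : 0 < Real.exp (2 * ν * (r - 1)) * (δ * η ^ 2) := by positivity
  linarith


lemma bdd_sub (d : ℕ → ℝ → E) (hc : ∀ k, Continuous (d k)) (b C : ℝ)
    (hb : ∀ᶠ k in atTop, ∫ s in (b - 1)..b, ‖d k s‖ ^ 2 ≤ C) :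
    ∃ s ∈ Icc (b - 1) b, ∃ χ : ℕ → ℕ, StrictMono χ ∧ ∃ M : ℝ, ∀ k, ‖d (χ k) s‖ ≤ M := by
  have hbb : b - 1 ≤ b := by linarith
  set μ := (volume : Measure ℝ).restrict (Ioc (b - 1) b) with hμ
  have hmk : ∀ k, Measurable fun s => ENNReal.ofReal (‖d k s‖ ^ 2) := fun k =>
    (ENNReal.continuous_ofReal.comp
      (by have := hc k; fun_prop : Continuous fun s => ‖d k s‖ ^ 2)).measurable
  have hfat := lintegral_liminf_le (μ := μ) (u := atTop)
    (f := fun k s => ENNReal.ofReal (‖d k s‖ ^ 2))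
    hmk
  have hle : liminf (fun k => ∫⁻ s, ENNReal.ofReal (‖d k s‖ ^ 2) ∂μ) atTop ≤ ENNReal.ofReal C := by
    apply liminf_le_of_frequently_le'
    apply Eventually.frequently
    filter_upwards [hb] with k hk
    rw [intervalIntegral.integral_of_le hbb] at hk
    rw [← ofReal_integral_eq_lintegral_ofReal]
    · exact ENNReal.ofReal_le_ofReal hk
    · have : Continuous fun s => ‖d k s‖ ^ 2 := by have := hc k; fun_prop
      exact (this.integrableOn_Icc (a := b - 1) (b := b)).mono_set Ioc_subset_Icc_self
    · exact ae_of_all _ fun s => by positivity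
  have hfin : ∫⁻ s, liminf (fun k => ENNReal.ofReal (‖d k s‖ ^ 2)) atTop ∂μ ≠ ⊤ :=
    ((hfat.trans hle).trans_lt ENNReal.ofReal_lt_top).ne
  have hmeas : Measurable fun s => liminf (fun k => ENNReal.ofReal (‖d k s‖ ^ 2)) atTop := by
    apply Measurable.liminf
    exact hmk
  have hae := ae_lt_top hmeas hfin
  have hmem : ∀ᵐ s ∂μ, s ∈ Ioc (b - 1) b := ae_restrict_mem measurableSet_Ioc
  have : NeBot (ae μ) := by
    rw [ae_neBot]
    intro h0
    have : μ univ = 0 := by rw [h0]; simp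
    simp [hμ] at this
  obtain ⟨s, hs, hsm⟩ := (hae.and hmem).exists
  obtain ⟨M, hM⟩ := ENNReal.lt_iff_exists_nnreal_btwn.1 hs
  have hfr := frequently_lt_of_liminf_lt (by isBoundedDefault) hM.1
  obtain ⟨χ, hχ, h⟩ := extraction_of_frequently_atTop hfr
  refine ⟨s, ⟨hsm.1.le, hsm.2⟩, χ, hχ, Real.sqrt M, fun k => ?_⟩
  have := h k
  apply Real.le_sqrt_of_sq_le
  have h2 := (ENNReal.ofReal_lt_coe_iff (by positivity)).1 this
  exact h2.le

/-- A family of trajectories with starting times going to `-∞`. -/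
structure Fam (U : ℝ → ℝ → E → E) (v : ℝ → E) (u : ℕ → ℝ → E) (a : ℕ → ℝ) : Prop where
  cont : ∀ k, Continuous (u k)
  traj : ∀ k, TrajFrom U (a k) (u k)
  lim : Tendsto a atTop atBot
  bdd : ∀ b ≤ 0, ∃ C, ∀ᶠ k in atTop, ∫ s in (b - 1)..b, ‖u k s - v s‖ ^ 2 ≤ C

lemma Fam.sub {u : ℕ → ℝ → E} {a : ℕ → ℝ} (F : Fam U v u a) {χ : ℕ → ℕ} (hχ : StrictMono χ) :
    Fam U v (fun k => u (χ k)) (fun k => a (χ k)) where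
  cont := fun k => F.cont _
  traj := fun k => F.traj _
  lim := F.lim.comp hχ.tendsto_atTop
  bdd := fun b hb => by
    obtain ⟨C, hC⟩ := F.bdd b hb
    exact ⟨C, hχ.tendsto_atTop.eventually hC⟩

lemma Fam.bddAt (S : Sys U v P e c δ ν σ) {u : ℕ → ℝ → E} {a : ℕ → ℝ} (F : Fam U v u a) (b : ℝ)
    (hb : b ≤ 0) : ∃ s ∈ Icc (b - 1) b, ∃ χ : ℕ → ℕ, StrictMono χ ∧ ∃ M : ℝ,
      ∀ k, ‖u (χ k) s‖ ≤ M := by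
  obtain ⟨C, hC⟩ := F.bdd b hb
  obtain ⟨s, hs, χ, hχ, M, hM⟩ := bdd_sub (fun k s => u k s - v s)
    (fun k => (F.cont k).sub S.vcont) b C hC
  refine ⟨s, hs, χ, hχ, M + ‖v s‖, fun k => ?_⟩
  have h1 := hM k
  have h2 := norm_add_le (u (χ k) s - v s) (v s)
  simp only [sub_add_cancel] at h2
  linarith

lemma quadV_abs_sub (P : E →L[ℝ] E) {x y : E} {M : ℝ} (hx : ‖x‖ ≤ M) (hy : ‖y‖ ≤ M) :
    |quadV P (x - y)| ≤ 2 * M * ‖P x - P y‖ := by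
  unfold quadV
  rw [map_sub]
  calc |⟪P x - P y, x - y⟫| ≤ ‖P x - P y‖ * ‖x - y‖ := abs_real_inner_le_norm _ _
    _ ≤ ‖P x - P y‖ * (2 * M) := by
      gcongr
      exact (norm_sub_le x y).trans (by linarith)
    _ = _ := by ring

lemma Fam.conv_com2 (S : Sys U v P e c δ ν σ)
    {tc : ℝ} (htc : 0 < tc) (hK : ∀ s (B : Set E), IsBounded B → IsCompact (closure (U tc s '' B)))
    {u : ℕ → ℝ → E} {a : ℕ → ℝ} (F : Fam U v u a) (b : ℝ) (hb : b ≤ 0) :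
    ∃ s ≤ b, ∃ χ : ℕ → ℕ, StrictMono χ ∧ ∃ y, Tendsto (fun k => u (χ k) s) atTop (𝓝 y) := by
  obtain ⟨s, hs, χ, hχ, M, hM⟩ := F.bddAt S (b - tc) (by linarith)
  have hc := hK s (Metric.closedBall 0 M) Metric.isBounded_closedBall
  have F' := F.sub hχ
  have hev : ∀ᶠ k in atTop, u (χ k) (tc + s) ∈ closure (U tc s '' Metric.closedBall 0 M) := by
    filter_upwards [F'.lim.eventually (eventually_le_atBot s)] with k hk
    apply subset_closure
    exact ⟨u (χ k) s, by simpa using hM k, (F'.traj k s hk tc htc.le).symm⟩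
  obtain ⟨y, -, χ', hχ', hy⟩ := hc.tendsto_subseq' hev.frequently
  exact ⟨tc + s, by linarith [hs.2], χ ∘ χ', hχ.comp hχ', y, hy⟩

lemma Fam.conv_com1 [CompleteSpace E] (S : Sys U v P e c δ ν σ) (hP : IsCompactOperator (⇑P))
    {u : ℕ → ℝ → E} {a : ℕ → ℝ} (F : Fam U v u a) (b : ℝ) (hb : b ≤ 0) :
    ∃ s ≤ b, ∃ χ : ℕ → ℕ, StrictMono χ ∧ ∃ y, Tendsto (fun k => u (χ k) s) atTop (𝓝 y) := by
  obtain ⟨s2, hs2, χ1, hχ1, M2, hM2⟩ := F.bddAt S b hb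
  obtain ⟨s1, hs1, χ2, hχ2, M1, hM1⟩ := (F.sub hχ1).bddAt S (b - 2) (by linarith)
  have hcpt : ∀ M, IsCompact (closure (P '' Metric.closedBall 0 M)) := fun M =>
    IsCompactOperator.isCompact_closure_image_closedBall (f := (P : E →ₗ[ℝ] E)) hP M
  obtain ⟨y1, -, χ3, hχ3, hy1⟩ := (hcpt M1).tendsto_subseq
    (x := fun k => P (u (χ1 (χ2 k)) s1)) (fun k => subset_closure ⟨_, by simpa using hM1 k, rfl⟩)
  obtain ⟨y2, -, χ4, hχ4, hy2⟩ := (hcpt M2).tendsto_subseq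
    (x := fun k => P (u (χ1 (χ2 (χ3 k))) s2))
    (fun k => subset_closure ⟨_, by simpa using hM2 _, rfl⟩)
  set χ : ℕ → ℕ := fun k => χ1 (χ2 (χ3 (χ4 k))) with hχdef
  have hχ : StrictMono χ := hχ1.comp (hχ2.comp (hχ3.comp hχ4))
  set w : ℕ → ℝ → E := fun k => u (χ k) with hw
  have F' : Fam U v w (fun k => a (χ k)) := F.sub hχ
  have hg1 : CauchySeq fun k => P (w k s1) := (hy1.comp hχ4.tendsto_atTop).cauchySeq
  have hg2 : CauchySeq fun k => P (w k s2) := hy2.cauchySeq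
  set M := max M1 M2 with hM
  have hwM1 : ∀ k, ‖w k s1‖ ≤ M := fun k => (hM1 _).trans (le_max_left _ _)
  have hwM2 : ∀ k, ‖w k s2‖ ≤ M := fun k => (hM2 _).trans (le_max_right _ _)
  have hM0 : 0 ≤ M := (norm_nonneg _).trans (hwM1 0)
  have hd := S.dpos
  have hn := S.npos
  set K := 2 * M / (δ * Real.exp (2 * ν * s1)) with hKdef
  have hK0 : 0 ≤ K := by positivity
  have h12 : s1 ≤ s2 := by linarith [hs1.2, hs2.1]
  have hcw : ∀ k, Continuous (w k) := F'.cont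
  have hest : ∀ k m, a (χ k) ≤ s1 → a (χ m) ≤ s1 →
      ∫ s in (b-2)..(b-1), ‖w k s - w m s‖ ^ 2 ≤
        K * (‖P (w k s1) - P (w m s1)‖ + ‖P (w k s2) - P (w m s2)‖) := by
    intro k m hk hm
    have hTk : TrajFrom U s1 (w k) := fun s hs => F'.traj k s (hk.trans hs)
    have hTm : TrajFrom U s1 (w m) := fun s hs => F'.traj m s (hm.trans hs)
    have hdis := S.diss' hTk hTm le_rfl h12
    have q1 := quadV_abs_sub P (hwM1 k) (hwM1 m)
    have q2 := quadV_abs_sub P (hwM2 k) (hwM2 m)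
    have x1 : Real.exp (2 * ν * s1) ≤ 1 := by
      rw [Real.exp_le_one_iff]; nlinarith [hs1.2]
    have x2 : Real.exp (2 * ν * s2) ≤ 1 := by
      rw [Real.exp_le_one_iff]; nlinarith [hs2.2]
    have r1 : Real.exp (2 * ν * s1) * quadV P (w k s1 - w m s1) ≤
        2 * M * ‖P (w k s1) - P (w m s1)‖ :=
      calc _ ≤ Real.exp (2 * ν * s1) * |quadV P (w k s1 - w m s1)| := by
            gcongr; exact le_abs_self _
        _ ≤ 1 * |quadV P (w k s1 - w m s1)| := by gcongr
        _ ≤ _ := by linarith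
    have r2 : -(Real.exp (2 * ν * s2) * quadV P (w k s2 - w m s2)) ≤
        2 * M * ‖P (w k s2) - P (w m s2)‖ :=
      calc _ = Real.exp (2 * ν * s2) * (-quadV P (w k s2 - w m s2)) := by ring
        _ ≤ Real.exp (2 * ν * s2) * |quadV P (w k s2 - w m s2)| := by
            gcongr; exact neg_le_abs _
        _ ≤ 1 * |quadV P (w k s2 - w m s2)| := by gcongr
        _ ≤ _ := by linarith
    have hcont : Continuous fun s => ‖w k s - w m s‖ ^ 2 := by
      have := hcw k; have := hcw m; fun_prop
    have r3 : Real.exp (2 * ν * s1) * ∫ s in (b-2)..(b-1), ‖w k s - w m s‖ ^ 2 ≤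
        ∫ s in s1..s2, Real.exp (2 * ν * s) * ‖w k s - w m s‖ ^ 2 := by
      rw [← intervalIntegral.integral_const_mul]
      calc _ ≤ ∫ s in s1..s2, Real.exp (2 * ν * s1) * ‖w k s - w m s‖ ^ 2 := by
            apply intervalIntegral.integral_mono_interval hs1.2 (by linarith) hs2.1
            · exact ae_of_all _ fun s => by positivity
            · exact (hcont.const_mul _).intervalIntegrable _ _
        _ ≤ _ := by
            apply intervalIntegral.integral_mono_on h12
            · exact (hcont.const_mul _).intervalIntegrable _ _
            · exact (by fun_prop : Continuous fun s => Real.exp (2 * ν * s) *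
                ‖w k s - w m s‖ ^ 2).intervalIntegrable _ _
            · intro s hs
              have := hs.1
              gcongr
    have r4 := mul_le_mul_of_nonneg_left r3 hd.le
    rw [hKdef, div_mul_eq_mul_div, le_div_iff₀ (by positivity)]
    linarith
  have hex : ∀ n : ℕ, ∀ᶠ k in atTop, ∀ i ≥ k, ∀ j ≥ k,
      ∫ s in (b-2)..(b-1), ‖w i s - w j s‖ ^ 2 < (1/4 : ℝ) ^ n := by
    intro n
    have hpos : (0:ℝ) < (1/4 : ℝ) ^ n / (2 * (K + 1)) := by positivity
    obtain ⟨N1, hN1⟩ := Metric.cauchySeq_iff.1 hg1 _ hpos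
    obtain ⟨N2, hN2⟩ := Metric.cauchySeq_iff.1 hg2 _ hpos
    obtain ⟨N3, hN3⟩ := eventually_atTop.1 (F'.lim.eventually (eventually_le_atBot s1))
    filter_upwards [eventually_ge_atTop N1, eventually_ge_atTop N2, eventually_ge_atTop N3]
      with k k1 k2 k3 i hi j hj
    have z1 := hN1 i (k1.trans hi) j (k1.trans hj)
    have z2 := hN2 i (k2.trans hi) j (k2.trans hj)
    rw [dist_eq_norm] at z1 z2
    refine (hest i j (hN3 i (k3.trans hi)) (hN3 j (k3.trans hj))).trans_lt ?_
    rw [lt_div_iff₀ (by positivity)] at z1 z2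
    have y1 := norm_nonneg (P (w i s1) - P (w j s1))
    have y2 := norm_nonneg (P (w i s2) - P (w j s2))
    nlinarith
  obtain ⟨φ, hφ, hφP⟩ := extraction_forall_of_eventually hex
  set μ := (volume : Measure ℝ).restrict (Ioc (b - 2) (b - 1)) with hμ
  have hae := MeasureTheory.Lp.ae_tendsto_of_cauchy_eLpNorm (μ := μ) (p := 2)
    (f := fun n => w (φ n)) (fun n => (hcw _).aestronglyMeasurable) (by norm_num)
    (B := fun n => ENNReal.ofReal ((1/2 : ℝ) ^ n)) (by
      rw [← ENNReal.ofReal_tsum_of_nonneg (fun n => by positivity)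
        (summable_geometric_of_lt_one (by norm_num) (by norm_num))]
      exact ENNReal.ofReal_ne_top) (by
      intro N n m hNn hNm
      have hlt := hφP N (φ n) (hφ.monotone hNn) (φ m) (hφ.monotone hNm)
      rw [intervalIntegral.integral_of_le (by linarith)] at hlt
      have hcont : Continuous (w (φ n) - w (φ m)) := (hcw _).sub (hcw _)
      have hcsq : Continuous fun s => ‖(w (φ n) - w (φ m)) s‖ ^ 2 := by fun_prop
      have hmem : MemLp (w (φ n) - w (φ m)) 2 μ := by
        rw [memLp_two_iff_integrable_sq_norm hcont.aestronglyMeasurable]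
        exact (hcsq.integrableOn_Icc (a := b - 2) (b := b - 1)).mono_set Ioc_subset_Icc_self
      rw [hmem.eLpNorm_eq_integral_rpow_norm (by norm_num) (by norm_num)]
      apply (ENNReal.ofReal_lt_ofReal_iff (by positivity)).2
      simp only [ENNReal.toReal_ofNat, Real.rpow_ofNat]
      rw [← one_div, ← Real.sqrt_eq_rpow]
      apply (Real.sqrt_lt' (by positivity)).2
      rw [← pow_mul, mul_comm, pow_mul]
      norm_num at hlt ⊢
      exact hlt)
  have hmem : ∀ᵐ s ∂μ, s ∈ Ioc (b - 2) (b - 1) := ae_restrict_mem measurableSet_Ioc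
  have : NeBot (ae μ) := by
    rw [ae_neBot]
    intro h0
    have : μ univ = 0 := by rw [h0]; simp
    simp [hμ] at this
  obtain ⟨s, ⟨y, hy⟩, hsm⟩ := (hae.and hmem).exists
  exact ⟨s, by linarith [hsm.2], χ ∘ φ, hχ.comp hφ, y, hy⟩


/-- The compactness alternative. -/
def Com (U : ℝ → ℝ → E → E) (P : E →L[ℝ] E) : Prop :=
  IsCompactOperator (⇑P) ∨ ∃ tc : ℝ, 0 < tc ∧
    ∀ s (B : Set E), IsBounded B → IsCompact (closure (U tc s '' B))

lemma Fam.conv [CompleteSpace E] (S : Sys U v P e c δ ν σ) (hcom : Com U P)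
    {u : ℕ → ℝ → E} {a : ℕ → ℝ} (F : Fam U v u a) (b : ℝ) (hb : b ≤ 0) :
    ∃ s ≤ b, ∃ χ : ℕ → ℕ, StrictMono χ ∧ ∃ y, Tendsto (fun k => u (χ k) s) atTop (𝓝 y) := by
  rcases hcom with h | ⟨tc, htc, h⟩
  · exact F.conv_com1 S h b hb
  · exact F.conv_com2 S htc h b hb

lemma Fam.diag [CompleteSpace E] (S : Sys U v P e c δ ν σ) (hcom : Com U P)
    {u : ℕ → ℝ → E} {a : ℕ → ℝ} (F : Fam U v u a) :
    ∃ G : Filter ℕ, G.NeBot ∧ G ≤ atTop ∧ ∀ n : ℕ, ∃ s ≤ -(n:ℝ), ∃ y,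
      Tendsto (fun k => u k s) G (𝓝 y) := by
  have step : ∀ (n : ℕ) (φ : {φ : ℕ → ℕ // StrictMono φ}), ∃ χ : {φ : ℕ → ℕ // StrictMono φ},
      ∃ s ≤ -(n:ℝ), ∃ y, Tendsto (fun k => u (φ.1 (χ.1 k)) s) atTop (𝓝 y) := by
    rintro n ⟨φ, hφ⟩
    obtain ⟨s, hs, χ, hχ, y, hy⟩ := (F.sub hφ).conv S hcom (-(n:ℝ)) (by simp)
    exact ⟨⟨χ, hχ⟩, s, hs, y, hy⟩
  choose g hg using step
  let Φ : ℕ → {φ : ℕ → ℕ // StrictMono φ} := fun n => Nat.rec ⟨id, strictMono_id⟩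
    (fun n φ => ⟨φ.1 ∘ (g n φ).1, φ.2.comp (g n φ).2⟩) n
  have hΦ : ∀ n, (Φ (n + 1)).1 = (Φ n).1 ∘ (g n (Φ n)).1 := fun n => rfl
  let Gs : ℕ → Filter ℕ := fun n => map (Φ n).1 atTop
  have hanti : Antitone Gs := by
    apply antitone_nat_of_succ_le
    intro n
    change map (Φ (n + 1)).1 atTop ≤ map (Φ n).1 atTop
    rw [hΦ, ← map_map]
    exact map_mono (g n (Φ n)).2.tendsto_atTop
  refine ⟨⨅ n, Gs n, ?_, ?_, ?_⟩
  · apply iInf_neBot_of_directed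
    · exact hanti.directed_ge
    · intro n
      exact map_neBot
  · exact (iInf_le _ 0).trans (by simp [Gs, Φ])
  · intro n
    obtain ⟨s, hs, y, hy⟩ := hg n (Φ n)
    refine ⟨s, hs, y, Tendsto.mono_left ?_ (iInf_le _ (n + 1))⟩
    change Tendsto _ (map (Φ (n + 1)).1 atTop) _
    rw [tendsto_map'_iff, hΦ]
    exact hy

lemma Fam.limit [CompleteSpace E] (S : Sys U v P e c δ ν σ) (hcom : Com U P)
    {u : ℕ → ℝ → E} {a : ℕ → ℝ} (F : Fam U v u a) :
    ∃ G : Filter ℕ, G.NeBot ∧ G ≤ atTop ∧ ∃ w : ℝ → E, Continuous w ∧ (∀ b, TrajFrom U b w) ∧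
      ∀ t, Tendsto (fun k => u k t) G (𝓝 (w t)) := by
  obtain ⟨G, hG, hGt, h⟩ := F.diag S hcom
  have ha : ∀ s, ∀ᶠ k in G, a k ≤ s := fun s => hGt (F.lim.eventually (eventually_le_atBot s))
  have hUc : ∀ t s, Continuous (U t s) := fun t s =>
    S.cont.comp (f := fun x : E => (t, s, x)) (by fun_prop)
  have hex : ∀ t, ∃ y, Tendsto (fun k => u k t) G (𝓝 y) := by
    intro t
    obtain ⟨n, hn⟩ := exists_nat_ge (-t)
    obtain ⟨s, hs, y, hy⟩ := h n
    refine ⟨U (t - s) s y, (((hUc (t - s) s).tendsto y).comp hy).congr' ?_⟩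
    filter_upwards [ha s] with k hk
    exact (S.traj_eq (F.traj k) hk (by linarith)).symm
  choose w hw using hex
  have htr : ∀ b, TrajFrom U b w := by
    intro b s _ t ht
    refine tendsto_nhds_unique (hw (t + s)) ((((hUc t s).tendsto _).comp (hw s)).congr' ?_)
    filter_upwards [ha s] with k hk
    exact (F.traj k s hk t ht).symm
  refine ⟨G, hG, hGt, w, ?_, htr, hw⟩
  rw [continuous_iff_continuousAt]
  intro t
  exact (S.traj_contOn (htr (t - 1))).continuousAt (Ici_mem_nhds (by linarith))

/-- The approximating trajectories. -/
lemma approx (S : Sys U v P e c δ ν σ) {ζ : ℝ} (hζ : 0 < ζ) {a : ℝ} (ha : a ≤ 0) :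
    ∃ u : ℝ → E, Continuous u ∧ TrajFrom U a u ∧ ⟪e, u 0 - v 0⟫ = ζ ∧
      ∀ t, a ≤ t → quadV P (u t - v t) ≤ 0 := by
  let x : ℝ → ℝ → E := fun s t => U (t - a) a (v a + s • e)
  have hxc : Continuous fun p : ℝ × ℝ => x p.1 p.2 :=
    S.cont.comp (f := fun p : ℝ × ℝ => (p.2 - a, a, v a + p.1 • e)) (by fun_prop)
  have hxT : ∀ s, TrajFrom U a (x s) := by
    intro s r hr t ht
    have := S.comp t (r - a) ht (by linarith) a (v a + s • e)
    simp only [x]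
    rw [show t + r - a = t + (r - a) by ring, this]
    simp
  have hxa : ∀ s, x s a - v a = s • e := by
    intro s
    simp [x, S.zero]
  have hee : ⟪e, e⟫ = 1 := by rw [real_inner_self_eq_norm_sq, S.unit]; norm_num
  have hcp := S.cpos
  have hfc : Continuous fun s => ⟪e, x s 0 - v 0⟫ := by
    have : Continuous fun s => x s 0 := hxc.comp (f := fun s : ℝ => (s, (0:ℝ))) (by fun_prop)
    fun_prop
  have hf0 : ⟪e, x 0 0 - v 0⟫ = 0 := by
    have : v 0 = x 0 0 := by
      simp only [x, zero_smul, add_zero]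
      exact S.traj_eq (S.vTraj a) le_rfl ha
    rw [this]; simp
  set s₁ := ζ * Real.exp (-(ν * a)) with hs₁
  have hs₁pos : 0 < s₁ := by positivity
  have hVa : quadV P (x s₁ a - v a) = -c * s₁ ^ 2 := by rw [hxa, S.onE]
  have hf1 : ζ ≤ ⟪e, x s₁ 0 - v 0⟫ := by
    have hneg : quadV P (x s₁ a - v a) < 0 := by
      rw [hVa]; nlinarith [mul_pos hcp (pow_pos hs₁pos 2)]
    have hord := S.order (hxT s₁) (S.vTraj a) ha hneg (by
      rw [hxa, inner_smul_right, hee]; linarith)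
    have hm := S.mono (hxT s₁) (S.vTraj a) le_rfl ha
    rw [hVa] at hm
    have hlow := S.lower (x s₁ 0 - v 0)
    have hexp : Real.exp (2 * ν * a) * s₁ ^ 2 = ζ ^ 2 := by
      rw [hs₁, mul_pow, ← Real.exp_nat_mul, mul_left_comm, ← Real.exp_add]
      have : 2 * ν * a + ((2:ℕ):ℝ) * -(ν * a) = 0 := by push_cast; ring
      rw [this]; simp
    simp only [mul_zero, Real.exp_zero, one_mul] at hm
    have h3 : c * ζ ^ 2 ≤ c * ⟪e, x s₁ 0 - v 0⟫ ^ 2 := by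
      rw [← hexp]; linarith
    have h4 := le_of_mul_le_mul_left h3 hcp
    exact le_of_sq_le_sq h4 hord.le
  obtain ⟨s, hs, hsζ⟩ := intermediate_value_Icc hs₁pos.le hfc.continuousOn
    (show ζ ∈ Icc _ _ from ⟨by rw [hf0]; exact hζ.le, hf1⟩)
  refine ⟨x s, hxc.comp (f := fun t : ℝ => (s, t)) (by fun_prop), hxT s, hsζ, fun t ht => ?_⟩
  have hm := S.mono (hxT s) (S.vTraj a) le_rfl ht
  rw [hxa, S.onE] at hm
  have h5 : Real.exp (2 * ν * a) * (-c * s ^ 2) ≤ 0 := by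
    have : 0 ≤ Real.exp (2 * ν * a) * (c * s ^ 2) := by positivity
    linarith
  exact nonpos_of_mul_nonpos_right (hm.trans h5) (Real.exp_pos _)

lemma vbdd (S : Sys U v P e c δ ν σ) : ∃ M, ∀ t, ‖v t‖ ≤ M := by
  obtain ⟨M, hM⟩ := isCompact_Icc.exists_bound_of_continuousOn
    (S.vcont.continuousOn (s := Icc 0 σ))
  refine ⟨M, fun t => ?_⟩
  obtain ⟨y, hy, hyt⟩ := (show Function.Periodic v σ from S.vper).exists_mem_Ico₀ S.spos t
  rw [hyt]
  exact hM y ⟨hy.1, hy.2.le⟩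

lemma amen (S : Sys U v P e c δ ν σ) {w : ℝ → E} (hwc : Continuous w) {C : ℝ}
    (h : ∀ t ≤ 0, ∫ s in t..0, Real.exp (2 * ν * s) * ‖w s - v s‖ ^ 2 ≤ C) : IsAmenable ν w := by
  have hvc := S.vcont
  have hn := S.npos
  have hd : IntegrableOn (fun s : ℝ => Real.exp (2 * ν * s) * ‖w s - v s‖ ^ 2) (Iic 0) := by
    apply integrableOn_Iic_of_intervalIntegral_norm_bounded (l := atBot) (a := id) C 0
    · intro t
      exact ((by fun_prop : Continuous fun s : ℝ => Real.exp (2 * ν * s) *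
        ‖w s - v s‖ ^ 2).integrableOn_Icc).mono_set Ioc_subset_Icc_self
    · exact tendsto_id
    · filter_upwards [eventually_le_atBot 0] with t ht
      refine le_of_eq_of_le ?_ (h t ht)
      apply intervalIntegral.integral_congr
      intro s _
      simp only [Real.norm_eq_abs]
      exact abs_of_nonneg (by positivity)
  obtain ⟨M, hM⟩ := S.vbdd
  have he : IntegrableOn (fun s : ℝ => Real.exp (2 * ν * s)) (Iic 0) :=
    integrableOn_exp_mul_Iic (by positivity) 0
  have hsum := (hd.const_mul 2).add (he.mul_const (2 * M ^ 2))
  refine Integrable.mono' hsum (by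
    exact (by fun_prop : Continuous fun s : ℝ => Real.exp (2 * ν * s) *
        ‖w s‖ ^ 2).aestronglyMeasurable) (ae_of_all _ fun s => ?_)
  simp only [Pi.add_apply]
  rw [Real.norm_eq_abs, abs_of_nonneg (by positivity)]
  have h1 : ‖w s‖ ^ 2 ≤ 2 * ‖w s - v s‖ ^ 2 + 2 * M ^ 2 := by
    have h2 := norm_add_le (w s - v s) (v s)
    rw [sub_add_cancel] at h2
    have h3 := hM s
    have h0 := norm_nonneg (w s - v s)
    have h00 := norm_nonneg (w s)
    have h4 : ‖w s‖ ≤ ‖w s - v s‖ + M := by linarith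
    have h5 : ‖w s‖ ^ 2 ≤ (‖w s - v s‖ + M) ^ 2 := by gcongr
    nlinarith [sq_nonneg (‖w s - v s‖ - M)]
  have := mul_le_mul_of_nonneg_left h1 (Real.exp_pos (2 * ν * s)).le
  linarith

/-- Existence of amenable trajectories close to `v` on a prescribed side. -/
lemma barrier [CompleteSpace E] (S : Sys U v P e c δ ν σ) (hcom : Com U P) {η : ℝ} (hη : 0 < η) :
    ∃ w : ℝ → E, Continuous w ∧ (∀ b, TrajFrom U b w) ∧ IsAmenable ν w ∧ ‖w 0 - v 0‖ < η ∧
      quadV P (w 0 - v 0) < 0 ∧ 0 < ⟪e, w 0 - v 0⟫ := by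
  obtain ⟨ρ, hρ, hsm⟩ := S.small hη
  have hcp := S.cpos
  have hd := S.dpos
  have hn := S.npos
  have hvc := S.vcont
  set ζ := Real.sqrt (ρ / c) with hζdef
  have hζ : 0 < ζ := Real.sqrt_pos.2 (by positivity)
  have hζ2 : c * ζ ^ 2 = ρ := by rw [hζdef, Real.sq_sqrt (by positivity)]; field_simp
  choose u huc huT hu0 huV using fun k : ℕ => S.approx hζ (a := -(k:ℝ)) (by simp)
  have hbd : ∀ (a' t : ℝ) (y : ℝ → E), TrajFrom U a' y → a' ≤ t → t ≤ 0 →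
      quadV P (y t - v t) ≤ 0 → ⟪e, y 0 - v 0⟫ = ζ →
      ∫ s in t..0, Real.exp (2 * ν * s) * ‖y s - v s‖ ^ 2 ≤ ρ / δ := by
    intro a' t y hy hat ht hV h0
    have h := S.diss' hy (S.vTraj a') hat ht
    have hl := S.lower (y 0 - v 0)
    rw [h0] at hl
    simp only [mul_zero, Real.exp_zero, one_mul] at h
    have h2 := mul_nonpos_of_nonneg_of_nonpos (Real.exp_pos (2 * ν * t)).le hV
    rw [le_div_iff₀ hd]
    linarith
  have F : Fam U v u (fun k => -(k:ℝ)) := by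
    refine ⟨huc, huT, tendsto_neg_atTop_atBot.comp tendsto_natCast_atTop_atTop, fun b hb => ?_⟩
    refine ⟨ρ / δ / Real.exp (2 * ν * (b - 1)), ?_⟩
    obtain ⟨N, hN⟩ := exists_nat_ge (-(b - 1))
    filter_upwards [eventually_ge_atTop N] with k hk
    have hkN : (N:ℝ) ≤ k := by exact_mod_cast hk
    have hc := huc k
    have h1 := hbd (-(k:ℝ)) (b - 1) (u k) (huT k) (by linarith) (by linarith)
      (huV k _ (by linarith)) (hu0 k)
    rw [le_div_iff₀ (Real.exp_pos _), mul_comm, ← intervalIntegral.integral_const_mul]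
    refine le_trans ?_ h1
    calc _ ≤ ∫ s in (b-1)..b, Real.exp (2 * ν * s) * ‖u k s - v s‖ ^ 2 := by
          apply intervalIntegral.integral_mono_on (by linarith)
          · exact (by fun_prop : Continuous fun s : ℝ => Real.exp (2 * ν * (b - 1)) *
              ‖u k s - v s‖ ^ 2).intervalIntegrable _ _
          · exact (by fun_prop : Continuous fun s : ℝ => Real.exp (2 * ν * s) *
              ‖u k s - v s‖ ^ 2).intervalIntegrable _ _
          · intro s hs
            have := hs.1
            gcongr
      _ ≤ _ := by
          apply intervalIntegral.integral_mono_interval le_rfl (by linarith) hb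
          · exact ae_of_all _ fun s => by positivity
          · exact (by fun_prop : Continuous fun s : ℝ => Real.exp (2 * ν * s) *
              ‖u k s - v s‖ ^ 2).intervalIntegrable _ _
  obtain ⟨G, hG, hGt, w, hwc, hwT, hw⟩ := F.limit S hcom
  have hw0 : ⟪e, w 0 - v 0⟫ = ζ := by
    have h1 : Tendsto (fun k => ⟪e, u k 0 - v 0⟫) G (𝓝 ⟪e, w 0 - v 0⟫) :=
      tendsto_const_nhds.inner ((hw 0).sub tendsto_const_nhds)
    simp only [hu0] at h1
    exact tendsto_nhds_unique h1 tendsto_const_nhds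
  have hwV : ∀ t, quadV P (w t - v t) ≤ 0 := by
    intro t
    have h1 : Tendsto (fun k => quadV P (u k t - v t)) G (𝓝 (quadV P (w t - v t))) :=
      ((quadV_cont P).tendsto _).comp ((hw t).sub tendsto_const_nhds)
    refine le_of_tendsto h1 ?_
    filter_upwards [hGt (F.lim.eventually (eventually_le_atBot t))] with k hk
    exact huV k t hk
  have hlow := S.lower (w 0 - v 0)
  rw [hw0] at hlow
  refine ⟨w, hwc, hwT, ?_, ?_, ?_, by rw [hw0]; exact hζ⟩
  · exact S.amen hwc (C := ρ / δ) fun t ht => hbd t t w (hwT t) le_rfl ht (hwV t) hw0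
  · refine hsm (-1) 0 w (hwT _) (by norm_num) ?_ (by linarith)
    have := hwV (0 - 1)
    gcongr
    linarith
  · have h := S.diss' (hwT (-1)) (S.vTraj (-1)) le_rfl (by norm_num : (-1:ℝ) ≤ 0)
    have hpos : 0 < ∫ s in (-1:ℝ)..0, Real.exp (2 * ν * s) * ‖w s - v s‖ ^ 2 := by
      apply intervalIntegral.integral_pos (by norm_num)
      · exact (by fun_prop : Continuous fun s : ℝ => Real.exp (2 * ν * s) *
              ‖w s - v s‖ ^ 2).continuousOn
      · intro s _; positivity
      · refine ⟨0, by norm_num, ?_⟩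
        have : w 0 - v 0 ≠ 0 := by
          intro h0
          rw [h0] at hw0
          simp at hw0
          linarith
        have := norm_pos_iff.2 this
        positivity
    have h2 := mul_nonpos_of_nonneg_of_nonpos (Real.exp_pos (2 * ν * (-1))).le (hwV (-1))
    have h3 := mul_pos hd hpos
    simp only [mul_zero, Real.exp_zero, one_mul] at h
    linarith

lemma upper (S : Sys U v P e c δ ν σ) [CompleteSpace E] (hcom : Com U P)
    (hst : ∀ ε > (0:ℝ), ∃ η > (0:ℝ), ∀ u : ℝ → E, Continuous u → (∀ b, TrajFrom U b u) →
      IsAmenable ν u → ‖u 0 - v 0‖ < η → ∀ t ≥ (0:ℝ), ‖u t - v t‖ < ε) {ε : ℝ} (hε : 0 < ε) :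
    ∃ η > 0, ∀ u, TrajFrom U 0 u → ‖u 0 - v 0‖ < η → ∀ t ≥ (0:ℝ), ⟪e, u t - v t⟫ < ε := by
  obtain ⟨η', hη', H⟩ := hst ε hε
  obtain ⟨w, hwc, hwT, hwA, hwη, hwV, hwe⟩ := S.barrier hcom hη'
  have hev : ∀ᶠ x in 𝓝 (v 0), quadV P (w 0 - x) < 0 ∧ 0 < ⟪e, w 0 - x⟫ := by
    have c1 : Continuous fun x => quadV P (w 0 - x) :=
      (quadV_cont P).comp (continuous_const.sub continuous_id)
    have c2 : Continuous fun x => ⟪e, w 0 - x⟫ := by fun_prop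
    exact (c1.continuousAt.eventually (gt_mem_nhds hwV)).and
      (c2.continuousAt.eventually (lt_mem_nhds hwe))
  obtain ⟨η, hη, hb⟩ := Metric.eventually_nhds_iff.1 hev
  refine ⟨η, hη, fun u hu hu0 t ht => ?_⟩
  obtain ⟨h1, h2⟩ := hb (y := u 0) (by rwa [dist_eq_norm])
  have h3 := S.order (hwT 0) hu ht h1 h2
  have h4 := H w hwc hwT hwA hwη t ht
  have h5 : ⟪e, w t - v t⟫ ≤ ‖w t - v t‖ := by
    have := real_inner_le_norm e (w t - v t)
    rwa [S.unit, one_mul] at this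
  have h6 : ⟪e, u t - v t⟫ = ⟪e, w t - v t⟫ - ⟪e, w t - u t⟫ := by
    rw [← inner_sub_right]; congr 1; abel
  linarith

lemma stable (S : Sys U v P e c δ ν σ) [CompleteSpace E] (hcom : Com U P)
    (hst : ∀ ε > (0:ℝ), ∃ η > (0:ℝ), ∀ u : ℝ → E, Continuous u → (∀ b, TrajFrom U b u) →
      IsAmenable ν u → ‖u 0 - v 0‖ < η → ∀ t ≥ (0:ℝ), ‖u t - v t‖ < ε) {ε : ℝ} (hε : 0 < ε) :
    ∃ η > 0, ∀ u, TrajFrom U 0 u → ‖u 0 - v 0‖ < η → ∀ t ≥ (0:ℝ), ‖u t - v t‖ < ε := by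
  obtain ⟨ρ, hρ, hsm⟩ := S.small hε
  have hcp := S.cpos
  have hn := S.npos
  set ζ := Real.sqrt (ρ / c) with hζdef
  have hζ : 0 < ζ := Real.sqrt_pos.2 (by positivity)
  have hζ2 : c * ζ ^ 2 = ρ := by rw [hζdef, Real.sq_sqrt (by positivity)]; field_simp
  obtain ⟨η1, hη1, H1⟩ := S.upper hcom hst hζ
  obtain ⟨η2, hη2, H2⟩ := S.negE.upper hcom hst hζ
  obtain ⟨η3, hη3, H3⟩ := S.unif hε
  have hev : ∀ᶠ x in 𝓝 (v 0), quadV P (x - v 0) < ρ := by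
    have c1 : Continuous fun x => quadV P (x - v 0) :=
      (quadV_cont P).comp (continuous_id.sub continuous_const)
    exact c1.continuousAt.eventually (gt_mem_nhds (by simpa [quadV_zero] using hρ))
  obtain ⟨η4, hη4, H4⟩ := Metric.eventually_nhds_iff.1 hev
  refine ⟨min (min η1 η2) (min η3 η4), by positivity, fun u hu hu0 t ht => ?_⟩
  simp only [lt_min_iff] at hu0
  obtain ⟨⟨b1, b2⟩, b3, b4⟩ := hu0
  rcases le_total t 1 with ht1 | ht1
  · have := H3 0 t (u 0) ht ht1 b3
    rw [← hu 0 le_rfl t ht] at this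
    simpa using this
  · refine hsm 0 t u hu (by linarith) ?_ ?_
    · have hm := S.mono hu (S.vTraj 0) le_rfl (by linarith : (0:ℝ) ≤ t - 1)
      have h4 := H4 (y := u 0) (by rwa [dist_eq_norm])
      simp only [mul_zero, Real.exp_zero, one_mul] at hm
      have h1 : 1 ≤ Real.exp (2 * ν * (t - 1)) := by
        rw [Real.one_le_exp_iff]
        have : 0 ≤ t - 1 := by linarith
        positivity
      nlinarith
    · have a1 := H1 u hu b1 t ht
      have a2 := H2 u hu b2 t ht
      rw [inner_neg_left] at a2
      have hl := S.lower (u t - v t)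
      have : ⟪e, u t - v t⟫ ^ 2 ≤ ζ ^ 2 := sq_le_sq' (by linarith) a1.le
      nlinarith

end Sys
end Aux

/-- Lemma 9: for a σ-periodic cocycle under (H1), (H2) with `j = 1`, (H3) and one of
(COM1) or (COM2), every amenable stable σ-periodic trajectory is Lyapunov stable. -/
theorem amenable_stable_implies_lyapunov_stable
    {H : Type*} [NormedAddCommGroup H] [InnerProductSpace ℝ H]
    [CompleteSpace H] [TopologicalSpace.SeparableSpace H]
    (σ : ℝ) (hσ : 0 < σ)
    (ψ : ℝ → AddCircle σ → H → H)
    (hcoc : IsCocycle (circleFlow σ) ψ)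
    (P : H →L[ℝ] H) (Hplus Hminus : Submodule ℝ H)
    (h1 : HypH1 P Hplus Hminus)
    (h2 : HypH2 Hminus 1)
    (δ ν : ℝ) (h3 : HypH3 ψ P δ ν)
    (hcom : IsCompactOperator (⇑P) ∨ HypCOM2 ψ)
    (q : AddCircle σ) (v : ℝ → H)
    (hv : IsCompleteTraj (circleFlow σ) ψ q v)
    (hvper : ∀ t : ℝ, v (t + σ) = v t)
    (hast : AmenableStable (circleFlow σ) ψ ν q v) :
    LyapunovStable ψ q v := by
  obtain ⟨hc0, hcc, hccont⟩ := hcoc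
  obtain ⟨hδ, hν, hdis⟩ := h3
  obtain ⟨hvc, hvt⟩ := hv
  -- a unit vector spanning `Hminus`
  obtain ⟨-, hdim⟩ := h2
  obtain ⟨e₀, he₀, hspan⟩ := finrank_eq_one_iff'.1 hdim
  have hn0 : ‖(e₀ : H)‖ ≠ 0 := by
    rw [norm_ne_zero_iff]
    exact fun h => he₀ (Subtype.ext h)
  set e : H := ‖(e₀ : H)‖⁻¹ • (e₀ : H) with he
  have hem : e ∈ Hminus := Hminus.smul_mem _ e₀.2
  have hunit : ‖e‖ = 1 := by
    rw [he, norm_smul, norm_inv, norm_norm, inv_mul_cancel₀ hn0]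
  have hene : e ≠ 0 := by
    intro h
    rw [h] at hunit
    simp at hunit
  have hes : ∀ x ∈ Hminus, ∃ a : ℝ, x = a • e := by
    intro x hx
    obtain ⟨a, ha⟩ := hspan ⟨x, hx⟩
    refine ⟨a * ‖(e₀ : H)‖, ?_⟩
    have hax : a • (e₀ : H) = x := congrArg Subtype.val ha
    rw [he, smul_smul, mul_assoc, mul_inv_cancel₀ hn0, mul_one, hax]
  have hee : ⟪e, e⟫ = 1 := by rw [real_inner_self_eq_norm_sq, hunit]; norm_num
  have hVe : quadV P e < 0 := h1.neg e hem hene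
  have honE : ∀ s : ℝ, quadV P (s • e) = -(-quadV P e) * s ^ 2 := by
    intro s
    simp only [quadV, map_smul, inner_smul_left, inner_smul_right]
    simp
    ring
  have horth : Hminusᗮ = Hplus := by
    rw [h1.orth, Submodule.orthogonal_orthogonal_eq_closure]
    exact h1.closed_plus.submodule_topologicalClosure_eq
  have hlower : ∀ x, -(-quadV P e) * ⟪e, x⟫ ^ 2 ≤ quadV P x := by
    intro x
    set y := x - ⟪e, x⟫ • e with hy
    have hyp : y ∈ Hplus := by
      rw [← horth, Submodule.mem_orthogonal]
      intro z hz
      obtain ⟨a, rfl⟩ := hes z hz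
      rw [hy, inner_smul_left, inner_sub_right, inner_smul_right, hee]
      simp
    have hx : x = y + ⟪e, x⟫ • e := by rw [hy]; abel
    have hVy : 0 ≤ quadV P y := by
      rcases eq_or_ne y 0 with h | h
      · rw [h, quadV_zero]
      · exact (h1.pos y hyp h).le
    have horth2 : ∀ z ∈ Hplus, ∀ z' ∈ Hminus, ⟪z, z'⟫ = 0 := by
      intro z hz z' hz'
      rw [h1.orth] at hz'
      exact (Submodule.mem_orthogonal _ _).1 hz' z hz
    have c1 : ⟪P y, e⟫ = 0 := horth2 _ (h1.inv_plus y hyp) _ hem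
    have c2 : ⟪P e, y⟫ = 0 := by
      rw [real_inner_comm]; exact horth2 _ hyp _ (h1.inv_minus e hem)
    have hexp : quadV P x = quadV P y + ⟪e, x⟫ ^ 2 * quadV P e := by
      set a := ⟪e, x⟫
      rw [hx]
      simp only [quadV, map_add, map_smul, inner_add_left, inner_add_right, inner_smul_left,
        inner_smul_right, c1, c2]
      simp
      ring
    rw [hexp]
    linarith
  -- the process on the real line
  let U : ℝ → ℝ → H → H := fun t s x => ψ (max t 0) (q + (s : AddCircle σ)) x
  have hU : ∀ t s x, 0 ≤ t → U t s x = ψ t (circleFlow σ s q) x := by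
    intro t s x ht
    simp only [U, max_eq_left ht, circleFlow]
  have hTr : ∀ u : ℝ → H, Continuous u → (∀ b, TrajFrom U b u) →
      IsCompleteTraj (circleFlow σ) ψ q u := by
    intro u hu hT
    refine ⟨hu, fun t s ht => ?_⟩
    rw [← hU t s _ ht]
    exact hT s s le_rfl t ht
  have hcoe : Continuous fun s : ℝ => (s : AddCircle σ) := AddCircle.continuous_mk' σ
  have S : Sys U v P e (-quadV P e) δ ν σ :=
    { cont := by
        have hmap : Continuous fun p : ℝ × ℝ × H =>
            ((max p.1 0, q + (p.2.1 : AddCircle σ), p.2.2) : ℝ × AddCircle σ × H) := by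
          have h2 : Continuous fun p : ℝ × ℝ × H => (p.2.1 : AddCircle σ) :=
            hcoe.comp (by fun_prop)
          exact (by fun_prop : Continuous fun p : ℝ × ℝ × H => max p.1 0).prodMk
            ((continuous_const.add h2).prodMk (by fun_prop))
        exact hccont.comp_continuous hmap fun p => show (0:ℝ) ≤ max p.1 0 from le_max_right _ _
      zero := fun s x => by rw [hU 0 s x le_rfl, hc0]
      comp := fun t r ht hr s x => by
        rw [hU _ _ _ (add_nonneg ht hr), hU _ _ _ ht, hU _ _ _ hr, hcc t r ht hr]
        congr 1
        simp only [circleFlow, AddCircle.coe_add]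
        abel
      per := fun t s x => by simp [U, AddCircle.coe_add, AddCircle.coe_period]
      spos := hσ
      dpos := hδ
      npos := hν
      cpos := by linarith
      diss := fun s x y r hr => by
        have h := hdis (circleFlow σ s q) x y 0 r le_rfl hr
        simp only [hc0, mul_zero, Real.exp_zero, one_mul] at h
        have hi : (∫ τ in (0:ℝ)..r, Real.exp (2 * ν * τ) * ‖U τ s x - U τ s y‖ ^ 2) =
            ∫ τ in (0:ℝ)..r, Real.exp (2 * ν * τ) *
              ‖ψ τ (circleFlow σ s q) x - ψ τ (circleFlow σ s q) y‖ ^ 2 := by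
          apply intervalIntegral.integral_congr
          intro τ hτ
          rw [uIcc_of_le hr] at hτ
          simp only [hU τ s _ hτ.1]
        rw [hi, hU r s x hr, hU r s y hr]
        exact h
      vcont := hvc
      vtraj := fun s t ht => by rw [hU t s _ ht]; exact hvt t s ht
      vper := hvper
      lower := hlower
      onE := honE
      unit := hunit }
  have hcom' : Sys.Com U P := by
    rcases hcom with h | ⟨tc, htc, h⟩
    · exact Or.inl h
    · refine Or.inr ⟨tc, htc, fun s B hB => ?_⟩
      have : U tc s = ψ tc (circleFlow σ s q) := funext fun x => hU tc s x htc.le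
      rw [this]
      exact h _ B hB
  intro ε hε
  obtain ⟨η, hη, Hs⟩ := S.stable hcom' (fun ε hε => by
    obtain ⟨η, hη, Hη⟩ := hast ε hε
    exact ⟨η, hη, fun u hu hT hA h0 => Hη u (hTr u hu hT) hA h0⟩) hε
  refine ⟨η, hη, fun u₀ hu₀ t ht => ?_⟩
  have hflow0 : circleFlow σ 0 q = q := by simp [circleFlow]
  have hT : TrajFrom U 0 (fun t => U t 0 u₀) := by
    intro s hs t ht
    have := S.comp t s ht hs 0 u₀
    simpa using this
  have h := Hs (fun t => U t 0 u₀) hT (by simpa [S.zero] using hu₀) t ht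
  simp only [hU t 0 u₀ ht, hflow0] at h
  exact h
end
end
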